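/- For positive integers k, t, and n with k ≥ 1, t ≥ 2, and n = 3k + 2t, every edge-coloring of the complete graph K_n that uses at least (3k + 2t − 3)(3k + 2t − 4)/2 + 2 colors yields a rainbow subgraph of K_n isomorphic to the spanning linear forest kP₃ ∪ tP₂. Consequently, AR(n, kP₃ ∪ tP₂) ≤ (3k + 2t − 3)(3k + 2t − 4)/2 + 1. -/

import Mathlib

open SimpleGraph

/-- The number of colors used by an edge-coloring `c` of the complete graph `K_n`. -/
noncomputable def colorCount (n : ℕ) (c : Sym2 (Fin n) → ℕ) : ℕ :=
  (c '' (⊤ : SimpleGraph (Fin n)).edgeSet).ncard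

/-- The linear forest `kP₃ ∪ tP₂`: the vertex-disjoint union of `k` paths on 3 vertices
and `t` paths on 2 vertices. -/
def linearForest (k t : ℕ) : SimpleGraph (Fin k × Fin 3 ⊕ Fin t × Fin 2) :=
  SimpleGraph.fromRel (fun u v =>
    (∃ (i : Fin k) (a b : Fin 3), u = Sum.inl (i, a) ∧ v = Sum.inl (i, b) ∧ (a : ℕ) + 1 = (b : ℕ)) ∨
    (∃ j : Fin t, u = Sum.inr (j, 0) ∧ v = Sum.inr (j, 1)))

/-- `G` (edge-colored by `c`) contains a rainbow subgraph isomorphic to `F`: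
there is an injective graph homomorphism from `F` to `G` under which the edges of `F`
receive pairwise distinct colors. -/
def HasRainbowCopy {V W : Type} (F : SimpleGraph V) (G : SimpleGraph W)
    (c : Sym2 W → ℕ) : Prop :=
  ∃ f : F →g G, Function.Injective f ∧
    Set.InjOn (fun e => c (Sym2.map (⇑f) e)) F.edgeSet

/-- The anti-Ramsey number `AR(n, F)`: the maximum number of colors in an edge-coloring
of `K_n` admitting no rainbow copy of `F`. -/
noncomputable def antiRamsey {V : Type} (n : ℕ) (F : SimpleGraph V) : ℕ :=
  sSup {m | ∃ c : Sym2 (Fin n) → ℕ, colorCount n c = m ∧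
    ¬ HasRainbowCopy F (⊤ : SimpleGraph (Fin n)) c}

open SimpleGraph

section Graph

set_option linter.unusedSectionVars false

variable {V : Type*} [DecidableEq V]

/-- `GraphForest R k t X`: the vertex set `X` is partitioned into `k` paths on 3 vertices and
`t` edges, all of whose edges lie in the complement of `R`. -/
inductive GraphForest (R : SimpleGraph V) : ℕ → ℕ → Finset V → Prop
  | nil : GraphForest R 0 0 ∅
  | edge {k t : ℕ} {X : Finset V} (a b : V) (ha : a ∈ X) (hb : b ∈ X) (hab : a ≠ b)
      (h : ¬ R.Adj a b) (hX : GraphForest R k t ((X.erase a).erase b)) :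
      GraphForest R k (t + 1) X
  | path {k t : ℕ} {X : Finset V} (a b d : V) (ha : a ∈ X) (hb : b ∈ X) (hd : d ∈ X)
      (hab : a ≠ b) (hbd : b ≠ d) (had : a ≠ d) (h₁ : ¬ R.Adj a b) (h₂ : ¬ R.Adj b d)
      (hX : GraphForest R k t (((X.erase a).erase b).erase d)) :
      GraphForest R (k + 1) t X

open Classical in
/-- The number of `R`-neighbours of `v` in `X`. -/
noncomputable def missDeg (R : SimpleGraph V) (v : V) (X : Finset V) : ℕ :=
  (X.filter (R.Adj v)).card

/-- Twice the number of edges of `R` inside `X`. -/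
noncomputable def missSum (R : SimpleGraph V) (X : Finset V) : ℕ :=
  ∑ v ∈ X, missDeg R v X

variable {R : SimpleGraph V} {X Y : Finset V} {u v a : V}

lemma missDeg_mono (h : Y ⊆ X) : missDeg R v Y ≤ missDeg R v X := by
  classical
  exact Finset.card_le_card (Finset.filter_subset_filter _ h)

open Classical in
lemma missDeg_erase (ha : a ∈ X) :
    missDeg R v X = missDeg R v (X.erase a) + if R.Adj v a then 1 else 0 := by
  unfold missDeg
  rw [Finset.filter_erase]
  split_ifs with h
  · rw [Finset.card_erase_add_one (by simp [ha, h])]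
  · rw [Finset.erase_eq_of_notMem (by simp [h]), add_zero]

lemma missDeg_erase_of_not_adj (h : ¬ R.Adj v a) : missDeg R v (X.erase a) = missDeg R v X := by
  classical
  by_cases ha : a ∈ X
  · simp [missDeg_erase ha, h]
  · rw [Finset.erase_eq_of_notMem ha]

lemma missDeg_erase_of_adj (ha : a ∈ X) (h : R.Adj v a) :
    missDeg R v X = missDeg R v (X.erase a) + 1 := by
  classical
  simp [missDeg_erase ha, h]

lemma missSum_erase (ha : a ∈ X) :
    missSum R X = missSum R (X.erase a) + 2 * missDeg R a X := by
  classical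
  unfold missSum
  rw [← Finset.add_sum_erase X _ ha, Finset.sum_congr rfl fun v _ => missDeg_erase (v := v) ha,
    Finset.sum_add_distrib, ← Finset.card_filter]
  have : ((X.erase a).filter fun v => R.Adj v a).card = missDeg R a X := by
    unfold missDeg
    congr 1
    ext w
    simp only [Finset.mem_filter, Finset.mem_erase]
    constructor
    · rintro ⟨⟨_, h⟩, h'⟩
      exact ⟨h, h'.symm⟩
    · rintro ⟨h, h'⟩
      exact ⟨⟨h'.ne', h⟩, h'.symm⟩
  omega

lemma even_missSum (X : Finset V) : Even (missSum R X) := by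
  induction X using Finset.induction_on with
  | empty => simp [missSum]
  | insert a s ha ih =>
    rw [missSum_erase (Finset.mem_insert_self a s), Finset.erase_insert ha]
    exact ih.add (even_two_mul _)

lemma missSum_le_mul {ρ : ℕ} (h : ∀ v ∈ X, missDeg R v X ≤ ρ) : missSum R X ≤ X.card * ρ := by
  simpa [missSum] using Finset.sum_le_sum h

lemma exists_not_adj (hv : v ∈ X) (h : missDeg R v X + 2 ≤ X.card) :
    ∃ u ∈ X, v ≠ u ∧ ¬ R.Adj v u := by
  classical
  by_contra! hc
  have : X.erase v ⊆ X.filter (R.Adj v) := fun u hu => by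
    simp only [Finset.mem_erase] at hu
    simp [hu.2, hc u hu.2 hu.1.symm]
  have := Finset.card_le_card this
  rw [Finset.card_erase_of_mem hv] at this
  unfold missDeg at h
  omega

lemma adj_of_card_le (hv : v ∈ X) (h : X.card ≤ missDeg R v X + 1) (hu : u ∈ X) (huv : u ≠ v) :
    R.Adj v u := by
  classical
  have hs : X.filter (R.Adj v) ⊆ X.erase v := fun w hw => by
    simp only [Finset.mem_filter] at hw
    simp [hw.1, hw.2.ne']
  have := Finset.eq_of_subset_of_card_le hs (by
    rw [Finset.card_erase_of_mem hv]; unfold missDeg at h; omega)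
  have hu' : u ∈ X.filter (R.Adj v) := by rw [this]; simp [hu, huv]
  exact (Finset.mem_filter.mp hu').2

lemma missSum_erase_erase (ha : a ∈ X) (hu : u ∈ X) (hau : a ≠ u) (h : ¬ R.Adj a u) :
    missSum R X = missSum R ((X.erase a).erase u) + 2 * missDeg R a X + 2 * missDeg R u X := by
  rw [missSum_erase ha, missSum_erase (X := X.erase a) (a := u) (by simp [hu, hau.symm]),
    missDeg_erase_of_not_adj fun h' => h h'.symm]
  ring

lemma card_erase_erase (ha : a ∈ X) (hu : u ∈ X) (hau : a ≠ u) :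
    ((X.erase a).erase u).card + 2 = X.card := by
  rw [← Finset.card_erase_add_one ha,
    ← Finset.card_erase_add_one (s := X.erase a) (a := u) (by simp [hu, hau.symm])]

lemma exists_missDeg_max (hX : X.Nonempty) : ∃ a ∈ X, ∀ v ∈ X, missDeg R v X ≤ missDeg R a X :=
  Finset.exists_max_image X (fun v => missDeg R v X) hX

/-- Among the non-`R`-neighbours of `u` in `Y`, one of maximal missing degree. -/
lemma exists_missDeg_max_not_adj (h : ∃ w ∈ Y, ¬ R.Adj u w) :
    ∃ q ∈ Y, ¬ R.Adj u q ∧ ∀ v ∈ Y, ¬ R.Adj u v → missDeg R v Y ≤ missDeg R q Y := by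
  classical
  obtain ⟨w, hw, hw'⟩ := h
  obtain ⟨q, hq, hmax⟩ := Finset.exists_max_image (Y.filter fun v => ¬ R.Adj u v)
    (fun v => missDeg R v Y) ⟨w, by simp [hw, hw']⟩
  simp only [Finset.mem_filter] at hq hmax
  exact ⟨q, hq.1, hq.2, fun v hv hv' => hmax v ⟨hv, hv'⟩⟩

lemma not_adj_of_missDeg_eq_zero (h : missDeg R v X = 0) (hu : u ∈ X) : ¬ R.Adj v u := by
  classical
  intro hvu
  unfold missDeg at h
  rw [Finset.card_eq_zero] at h
  have : u ∈ X.filter (R.Adj v) := by simp [hu, hvu]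
  simp [h] at this

lemma missSum_eq_zero (h : ∀ v ∈ X, missDeg R v X = 0) : missSum R X = 0 :=
  Finset.sum_eq_zero h

lemma missDeg_erase_self : missDeg R a (X.erase a) = missDeg R a X :=
  missDeg_erase_of_not_adj (R.loopless.irrefl a)

/-- A graph on `N = 3k + 2t` vertices with `t ≥ 1` missing at most `N - 2` edges is spanned by
`kP₃ ∪ tP₂`. -/
theorem graphForest_of_missSum_le (k t : ℕ) (X : Finset V) (ht : 1 ≤ t)
    (hX : X.card = 3 * k + 2 * t) (hM : missSum R X ≤ 2 * (X.card - 2)) :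
    GraphForest R k t X := by
  classical
  induction hN : X.card using Nat.strong_induction_on generalizing k t X with
  | _ N ih =>
  subst hN
  obtain ⟨a, ha, hmax⟩ := exists_missDeg_max (R := R) (X := X) (Finset.card_pos.mp (by omega))
  have h₁ := missSum_erase (R := R) ha
  obtain ⟨t, rfl⟩ : ∃ t', t = t' + 1 := ⟨t - 1, by omega⟩
  have hle := missSum_le_mul hmax
  obtain ⟨w, hw, haw, haw'⟩ := exists_not_adj (R := R) ha (by omega)
  by_cases ht2 : t = 0
  · subst ht2
    rcases k with _ | k
    · refine .edge a w ha hw haw haw' ?_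
      have := card_erase_erase ha hw haw
      rw [Finset.card_eq_zero.mp (show ((X.erase a).erase w).card = 0 by omega)]
      exact .nil
    have h₂ := missSum_erase_erase ha hw haw haw'
    have hcY := card_erase_erase ha hw haw
    have hwm := hmax w hw
    set Y := (X.erase a).erase w with hY
    have hmemY : ∀ v, v ∈ Y ↔ v ≠ w ∧ v ≠ a ∧ v ∈ X := by simp [hY]
    have hq : ∃ q ∈ Y, ¬ R.Adj w q := by
      by_contra! hc
      have : Y ⊆ X.filter (R.Adj w) := fun q hq => by
        simp [hc q hq, ((hmemY q).1 hq).2.2]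
      have := Finset.card_le_card this
      unfold missDeg at *
      omega
    obtain ⟨q, hq, hwq, hqmax⟩ := exists_missDeg_max_not_adj hq
    have hq' := (hmemY q).1 hq
    refine .path a w q ha hw hq'.2.2 haw hq'.1.symm hq'.2.1.symm haw' hwq ?_
    have hcZ := Finset.card_erase_add_one hq
    have h₃ := missSum_erase (R := R) hq
    refine ih (Y.erase q).card ?_ k 1 (Y.erase q) le_rfl ?_ ?_ rfl
    · omega
    · omega
    · have hev := even_missSum (R := R) (Y.erase q)
      rcases Nat.eq_zero_or_pos (missDeg R w X + missDeg R q Y) with h0 | h0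
      · have : missSum R Y = 0 := missSum_eq_zero fun v hv => by
          have := hqmax v hv (not_adj_of_missDeg_eq_zero (by omega) ((hmemY v).1 hv).2.2)
          omega
        omega
      · rcases Nat.lt_or_ge 1 (missDeg R a X) with h | h
        · omega
        · have : missDeg R a X = 0 ∨ missDeg R a X = 1 := by omega
          rcases this with h | h
          · rw [h] at hle; omega
          · rw [h] at hle
            obtain ⟨s, hs⟩ := hev
            omega
  · obtain ⟨u, hu, hau', hau⟩ := exists_missDeg_max_not_adj (R := R) (u := a) (Y := X.erase a)
      ⟨w, by simp [hw, haw.symm], haw'⟩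
    have hu' := Finset.mem_erase.mp hu
    have h₂ := missSum_erase_erase ha hu'.2 hu'.1.symm hau'
    have hcY := card_erase_erase ha hu'.2 hu'.1.symm
    refine .edge a u ha hu'.2 hu'.1.symm hau' ?_
    refine ih _ ?_ k t _ (by omega) ?_ ?_ rfl
    · omega
    · omega
    · have : missDeg R a X = 0 ∨ missDeg R a X = 1 ∨ 2 ≤ missDeg R a X := by omega
      rcases this with h | h | h
      · rw [h] at hle; omega
      · rcases Nat.eq_zero_or_pos (missDeg R u X) with h0 | h0
        · have : missSum R (X.erase a) = 0 := missSum_eq_zero fun v hv => by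
            have hv' := Finset.mem_erase.mp hv
            by_cases hav : R.Adj a v
            · have := missDeg_erase_of_adj ha hav.symm
              have := hmax v hv'.2
              omega
            · have := hau v hv hav
              have := missDeg_erase_of_not_adj (X := X) (v := u) (a := a) fun h' => hau' h'.symm
              omega
          omega
        · omega
      · omega

lemma missSum_le_of_not_adj {y ρ : ℕ} (h : ∀ v ∈ Y, ¬ R.Adj u v → missDeg R v Y ≤ y)
    (hρ : ∀ v ∈ Y, missDeg R v Y ≤ ρ) :
    missSum R Y ≤ Y.card * y + missDeg R u Y * ρ := by
  classical
  calc missSum R Y ≤ ∑ v ∈ Y, (y + if R.Adj u v then ρ else 0) := by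
        refine Finset.sum_le_sum fun v hv => ?_
        split_ifs with huv
        · exact (hρ v hv).trans (Nat.le_add_left _ _)
        · exact h v hv huv
    _ = Y.card * y + missDeg R u Y * ρ := by
        rw [Finset.sum_add_distrib, ← Finset.sum_filter]
        simp [missDeg]

lemma two_mul_missDeg_le (hv : v ∈ X) : 2 * missDeg R v X ≤ missSum R X := by
  rw [missSum_erase hv]
  omega

lemma GraphForest.of_path {b d : V} (ha : a ∈ X) (hb : b ∈ X) (hd : d ∈ X)
    (hab : a ≠ b) (hbd : b ≠ d) (had : a ≠ d) (h₁ : ¬ R.Adj a b) (h₂ : ¬ R.Adj b d)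
    (hX : X.card = 3) : GraphForest R 1 0 X := by
  refine .path a b d ha hb hd hab hbd had h₁ h₂ ?_
  have := card_erase_erase ha hb hab
  have hd' : d ∈ (X.erase a).erase b := by simp [hd, hbd.symm, had.symm]
  have := Finset.card_erase_add_one hd'
  rw [Finset.card_eq_zero.mp (show (((X.erase a).erase b).erase d).card = 0 by omega)]
  exact .nil

lemma graphForest_one_zero (hX : X.card = 3) (hM : missSum R X ≤ 2) : GraphForest R 1 0 X := by
  obtain ⟨b, hb, hb0⟩ : ∃ b ∈ X, missDeg R b X = 0 := by
    by_contra! hc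
    have := Finset.card_nsmul_le_sum X (fun v => missDeg R v X) 1
      fun v hv => Nat.one_le_iff_ne_zero.mpr (hc v hv)
    unfold missSum at hM
    simp only [smul_eq_mul] at this
    omega
  have hc := Finset.card_erase_add_one hb
  obtain ⟨p, q, hpq, hX'⟩ := Finset.card_eq_two.mp (show (X.erase b).card = 2 by omega)
  have hp : p ∈ X.erase b := by simp [hX']
  have hq : q ∈ X.erase b := by simp [hX']
  simp only [Finset.mem_erase] at hp hq
  exact .of_path hp.2 hb hq.2 hp.1 hq.1.symm hpq
    (fun h => not_adj_of_missDeg_eq_zero hb0 hp.2 h.symm)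
    (not_adj_of_missDeg_eq_zero hb0 hq.2) hX

/-- A graph on five vertices missing at most five edges and without isolated vertices is
spanned by `P₃ ∪ P₂`. -/
lemma graphForest_one_one (hX : X.card = 5) (hM : missSum R X ≤ 10)
    (hiso : ∀ v ∈ X, missDeg R v X + 2 ≤ X.card) : GraphForest R 1 1 X := by
  classical
  obtain ⟨a, ha, hmax⟩ := exists_missDeg_max (R := R) (X := X) (Finset.card_pos.mp (by omega))
  obtain ⟨u, hu, hau, hau'⟩ := exists_not_adj ha (hiso a ha)
  have hsum := missSum_erase_erase ha hu hau hau'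
  have hc := card_erase_erase ha hu hau
  have hle := missSum_le_mul hmax
  have hev := even_missSum (R := R) X
  have hlt := hiso a ha
  by_cases hY : missSum R ((X.erase a).erase u) ≤ 2
  · exact .edge a u ha hu hau hau' (graphForest_one_zero (by omega) hY)
  have hcases : missDeg R a X = 2 ∨ (missDeg R a X = 3 ∧ missDeg R u X = 0) := by
    have : missDeg R a X = 0 ∨ missDeg R a X = 1 ∨ missDeg R a X = 2 ∨ missDeg R a X = 3 := by
      omega
    obtain ⟨e, he⟩ := hev
    rcases this with h | h | h | h <;> rw [h, hX] at hle <;> omega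
  rcases hcases with h2 | ⟨h3, hu0⟩
  · have hp : (X.filter (R.Adj a)).card = 2 := h2
    have hn : ((X.erase a).filter fun v => ¬ R.Adj a v).card = 2 := by
      have h := Finset.card_filter_add_card_filter_not (s := X.erase a) (R.Adj a)
      have h' : ((X.erase a).filter (R.Adj a)).card = 2 :=
        (missDeg_erase_self (R := R) (a := a) (X := X)).trans h2
      have := Finset.card_erase_add_one ha
      omega
    obtain ⟨p, q, hpq, hpq'⟩ := Finset.card_eq_two.mp hp
    obtain ⟨w, s, hws, hws'⟩ := Finset.card_eq_two.mp hn
    have hp : p ∈ X.filter (R.Adj a) := by simp [hpq']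
    have hq : q ∈ X.filter (R.Adj a) := by simp [hpq']
    have hw : w ∈ (X.erase a).filter fun v => ¬ R.Adj a v := by simp [hws']
    have hs : s ∈ (X.erase a).filter fun v => ¬ R.Adj a v := by simp [hws']
    simp only [Finset.mem_filter, Finset.mem_erase] at hp hq hw hs
    have hpa := hp.2.ne'
    have hqa := hq.2.ne'
    have hpw : p ≠ w := by rintro rfl; exact hw.2 hp.2
    have hps : p ≠ s := by rintro rfl; exact hs.2 hp.2
    have hqw : q ≠ w := by rintro rfl; exact hw.2 hq.2
    have hqs : q ≠ s := by rintro rfl; exact hs.2 hq.2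
    by_cases hadj : R.Adj p q
    · have hpw' : ¬ R.Adj p w := fun h => by
        have := hmax p hp.1
        have h3 : 2 < (X.filter (R.Adj p)).card := Finset.two_lt_card.mpr
          ⟨a, by simp [ha, hp.2.symm], q, by simp [hq.1, hadj], w, by simp [hw.1.2, h],
            hqa.symm, hw.1.1.symm, hqw⟩
        unfold missDeg at *
        omega
      have hqw' : ¬ R.Adj q w := fun h => by
        have := hmax q hq.1
        have h3 : 2 < (X.filter (R.Adj q)).card := Finset.two_lt_card.mpr
          ⟨a, by simp [ha, hq.2.symm], p, by simp [hp.1, hadj.symm], w, by simp [hw.1.2, h],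
            hpa.symm, hw.1.1.symm, hpw⟩
        unfold missDeg at *
        omega
      refine .edge a s ha hs.1.2 hs.1.1.symm hs.2 (.of_path (a := p) (b := w) (d := q)
        ?_ ?_ ?_ hpw hqw.symm hpq hpw' (fun h => hqw' h.symm) ?_)
      · simp [hp.1, hpa, hps]
      · simp [hw.1, hws]
      · simp [hq.1, hqa, hqs]
      · have := card_erase_erase ha hs.1.2 hs.1.1.symm
        omega
    · refine .edge p q hp.1 hq.1 hpq hadj (.of_path (a := w) (b := a) (d := s)
        ?_ ?_ ?_ hw.1.1 hs.1.1.symm hws (fun h => hw.2 h.symm) hs.2 ?_)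
      · simp [hw.1, hpw.symm, hqw.symm]
      · simp [ha, hpa.symm, hqa.symm]
      · simp [hs.1, hps.symm, hqs.symm]
      · have := card_erase_erase hp.1 hq.1 hpq
        omega
  · set Y := (X.erase a).erase u with hYdef
    have hmemY : ∀ v, v ∈ Y ↔ v ≠ u ∧ v ≠ a ∧ v ∈ X := by simp [hYdef]
    obtain ⟨p, hp, q, hq, hpq, hpq'⟩ : ∃ p ∈ Y, ∃ q ∈ Y, p ≠ q ∧ ¬ R.Adj p q := by
      by_contra! hcon
      have h6 := Finset.card_nsmul_le_sum Y (fun v => missDeg R v Y) 2 fun v hv => by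
        by_contra! hlt
        obtain ⟨q, hq, hvq, hvq'⟩ := exists_not_adj (R := R) hv (by omega)
        exact hvq' (hcon v hv q hq hvq)
      simp only [smul_eq_mul] at h6
      have : ∑ v ∈ Y, missDeg R v Y = missSum R Y := rfl
      omega
    have hcs := card_erase_erase hp hq hpq
    obtain ⟨s, hs⟩ := Finset.card_eq_one.mp (show ((Y.erase p).erase q).card = 1 by omega)
    have hs' : s ∈ (Y.erase p).erase q := by simp [hs]
    simp only [Finset.mem_erase, hmemY] at hs'
    rw [hmemY] at hp hq
    refine .edge p q hp.2.2 hq.2.2 hpq hpq' (.of_path (a := a) (b := u) (d := s)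
        ?_ ?_ ?_ hau hs'.2.2.1.symm hs'.2.2.2.1.symm hau'
        (not_adj_of_missDeg_eq_zero hu0 hs'.2.2.2.2) ?_)
    · simp [ha, hp.2.1.symm, hq.2.1.symm]
    · simp [hu, hp.1.symm, hq.1.symm]
    · simp [hs']
    · have := card_erase_erase hp.2.2 hq.2.2 hpq
      omega

/-- A graph on `N = 3k + 2t` vertices with `k, t ≥ 1` missing at most `2N - 5` edges and without
isolated vertices is spanned by `kP₃ ∪ tP₂`. -/
theorem graphForest_of_no_isolated (k t : ℕ) (X : Finset V) (hk : 1 ≤ k) (ht : 1 ≤ t)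
    (hX : X.card = 3 * k + 2 * t) (hM : missSum R X ≤ 2 * (2 * X.card - 5))
    (hiso : ∀ v ∈ X, missDeg R v X + 2 ≤ X.card) : GraphForest R k t X := by
  classical
  induction hN : X.card using Nat.strong_induction_on generalizing k t X with
  | _ N ih =>
  subst hN
  by_cases h5 : X.card = 5
  · obtain rfl : k = 1 := by omega
    obtain rfl : t = 1 := by omega
    exact graphForest_one_one h5 (by omega) hiso
  obtain ⟨a, ha, hmax⟩ := exists_missDeg_max (R := R) (X := X) (Finset.card_pos.mp (by omega))
  obtain ⟨u, hu, hau, hau'⟩ := exists_not_adj ha (hiso a ha)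
  have hρ := hiso a ha
  have hmono : ∀ v Y, Y ⊆ X → v ∈ X → missDeg R v Y ≤ missDeg R a X := fun v Y hYX hv =>
    (missDeg_mono hYX).trans (hmax v hv)
  rcases Nat.lt_or_ge 1 k with hk2 | hk1
  · obtain ⟨k, rfl⟩ : ∃ k', k = k' + 1 := ⟨k - 1, by omega⟩
    have hsum := missSum_erase_erase ha hu hau hau'
    have hcY := card_erase_erase ha hu hau
    have hz := hmax u hu
    set Y := (X.erase a).erase u with hYdef
    have hYX : Y ⊆ X := (Finset.erase_subset _ _).trans (Finset.erase_subset _ _)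
    have hmemY : ∀ v, v ∈ Y ↔ v ≠ u ∧ v ≠ a ∧ v ∈ X := by simp [hYdef]
    have hq : ∃ q ∈ Y, ¬ R.Adj u q := by
      by_contra! hc
      have : Y ⊆ X.filter (R.Adj u) := fun q hq => by simp [hc q hq, hYX hq]
      have := Finset.card_le_card this
      unfold missDeg at *
      omega
    obtain ⟨q, hq, huq, hqmax⟩ := exists_missDeg_max_not_adj hq
    have hq' := (hmemY q).1 hq
    have hcZ := Finset.card_erase_add_one hq
    have hsumZ := missSum_erase (R := R) hq
    have hZY : Y.erase q ⊆ Y := Finset.erase_subset _ _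
    have hqρ := hmono q Y hYX hq'.2.2
    have hpath : missSum R (Y.erase q) ≤ 2 * ((Y.erase q).card - 2) →
        GraphForest R (k + 1) t X := fun h =>
      .path a u q ha hu hq'.2.2 hau hq'.1.symm hq'.2.1.symm hau' huq
        (graphForest_of_missSum_le k t (Y.erase q) ht (by omega) h)
    by_cases hisoZ : ∀ v ∈ Y.erase q, missDeg R v (Y.erase q) + 2 ≤ (Y.erase q).card
    · by_cases hMZ : missSum R (Y.erase q) ≤ 2 * (2 * (Y.erase q).card - 5)
      · exact .path a u q ha hu hq'.2.2 hau hq'.1.symm hq'.2.1.symm hau' huq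
          (ih (Y.erase q).card (by omega) k t (Y.erase q) (by omega) ht (by omega) hMZ hisoZ rfl)
      · exfalso
        have hbound := missSum_le_of_not_adj hqmax fun v hv => hmono v Y hYX (hYX hv)
        have hzY : missDeg R u Y ≤ missDeg R u X := missDeg_mono hYX
        obtain ⟨e, he⟩ := even_missSum (R := R) (Y.erase q)
        have hs5 : missDeg R a X + missDeg R u X + missDeg R q Y ≤ 5 := by omega
        have hmul : missDeg R u Y * missDeg R a X ≤ missDeg R u X * missDeg R a X :=
          Nat.mul_le_mul_right _ hzY
        generalize missDeg R a X = ρ at *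
        generalize missDeg R u X = z at *
        generalize missDeg R q Y = y at *
        have hz' : z ≤ 2 := by omega
        have hy' : y ≤ 2 := by omega
        interval_cases y <;> interval_cases z <;> omega
    · push Not at hisoZ
      obtain ⟨v, hvZ, hviso⟩ := hisoZ
      have hvY := hZY hvZ
      have hvX := hYX hvY
      have hv' := (hmemY v).1 hvY
      have hZYv : missDeg R v (Y.erase q) ≤ missDeg R v Y := missDeg_mono hZY
      by_cases huv : R.Adj u v
      · have hvY1 : missDeg R v (X.erase a) = missDeg R v Y + 1 :=
          missDeg_erase_of_adj (by simp [hu, hau.symm]) huv.symm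
        have hvX1 := missDeg_erase (R := R) (v := v) ha
        have hvρ := hmax v hvX
        have hv2 := two_mul_missDeg_le (R := R) hvY
        have hz1 : 1 ≤ missDeg R u X := Finset.card_pos.mpr ⟨v, by simp [hvX, huv]⟩
        rcases Nat.lt_or_ge (missDeg R a X + 2) X.card with hlt | hge
        · have hva : ¬ R.Adj v a := fun h => by
            rw [if_pos h] at hvX1
            omega
          have hsumv := missSum_erase (R := R) hvY
          refine .path u a v hu ha hvX hau.symm hv'.2.1.symm hv'.1.symm (fun h => hau' h.symm)
            (fun h => hva h.symm) ?_
          rw [Finset.erase_right_comm (a := u), ← hYdef]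
          have := Finset.card_erase_add_one hvY
          refine graphForest_of_missSum_le k t (Y.erase v) ht (by omega) ?_
          omega
        · obtain ⟨w, hw⟩ : ((Y.erase q).erase v).Nonempty := by
            have := Finset.card_erase_add_one hvZ
            exact Finset.card_pos.mp (by omega)
          have hw' := Finset.mem_erase.mp hw
          have hvw : R.Adj v w := adj_of_card_le hvZ (by omega) hw'.2 hw'.1
          have hwY := hZY hw'.2
          have huw : ¬ R.Adj u w := fun h => by
            have : 1 < (X.filter (R.Adj u)).card := Finset.one_lt_card.mpr
              ⟨v, by simp [hvX, huv], w, by simp [hYX hwY, h], hw'.1.symm⟩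
            unfold missDeg at *
            omega
          have hw1 : 1 ≤ missDeg R w Y := Finset.card_pos.mpr ⟨v, by simp [hvY, hvw.symm]⟩
          have := hqmax w hwY huw
          exact hpath (by omega)
      · have := hqmax v hvY huv
        exact hpath (by omega)
  · obtain rfl : k = 1 := by omega
    obtain ⟨t, rfl⟩ : ∃ t', t = t' + 1 := ⟨t - 1, by omega⟩
    by_cases hgood : ∃ u ∈ X, a ≠ u ∧ ¬ R.Adj a u ∧
        missSum R ((X.erase a).erase u) + 18 ≤ 4 * X.card
    · obtain ⟨u, hu, hau, hau', hMY⟩ := hgood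
      have hsum := missSum_erase_erase ha hu hau hau'
      have hcY := card_erase_erase ha hu hau
      by_cases hisoY : ∀ v ∈ (X.erase a).erase u,
          missDeg R v ((X.erase a).erase u) + 2 ≤ ((X.erase a).erase u).card
      · exact .edge a u ha hu hau hau' (ih _ (by omega) 1 t ((X.erase a).erase u) le_rfl (by omega)
          (by omega) (by omega) hisoY rfl)
      · push Not at hisoY
        obtain ⟨w, hw, hwiso⟩ := hisoY
        have hw' : w ≠ u ∧ w ≠ a ∧ w ∈ X := by simpa using hw
        have hwX1 := missDeg_erase (R := R) (v := w) ha
        have hwX2 := missDeg_erase (R := R) (v := w) (X := X.erase a) (a := u)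
          (by simp [hu, hau.symm])
        have hwρ := hmax w hw'.2.2
        have hwi := hiso w hw'.2.2
        have hsumw := missSum_erase (R := R) hw
        have hcw := Finset.card_erase_add_one hw
        have hH : GraphForest R 0 (t + 1) (((X.erase a).erase u).erase w) :=
          graphForest_of_missSum_le 0 (t + 1) _ (by omega) (by omega) (by omega)
        by_cases hwu : R.Adj w u
        · have hwa : ¬ R.Adj w a := fun h => by
            rw [if_pos h] at hwX1
            rw [if_pos hwu] at hwX2
            omega
          refine .path u a w hu ha hw'.2.2 hau.symm hw'.2.1.symm hw'.1.symm (fun h => hau' h.symm)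
            (fun h => hwa h.symm) ?_
          rwa [Finset.erase_right_comm (a := u)]
        · exact .path a u w ha hu hw'.2.2 hau hw'.1.symm hw'.2.1.symm hau' (fun h => hwu h.symm) hH
    · exfalso
      push Not at hgood
      have hle := missSum_le_mul hmax
      have hbound : ∀ v ∈ X, a ≠ v → ¬ R.Adj a v → missDeg R a X + missDeg R v X ≤ 3 := by
        intro v hv hav hav'
        have := hgood v hv hav hav'
        have := missSum_erase_erase ha hv hav hav'
        obtain ⟨e, he⟩ := even_missSum (R := R) ((X.erase a).erase v)
        omega
      have hu3 := hbound u hu hau hau'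
      have hsum := missSum_erase_erase ha hu hau hau'
      have h16 := hgood u hu hau hau'
      have hρ3 : missDeg R a X = 3 := by
        have : missDeg R a X = 0 ∨ missDeg R a X = 1 ∨ missDeg R a X = 2 ∨ missDeg R a X = 3 := by
          omega
        obtain ⟨e, he⟩ := even_missSum (R := R) ((X.erase a).erase u)
        rcases this with h | h | h | h <;> rw [h] at hle <;> omega
      have h0 : ∀ v ∈ X.erase a, ¬ R.Adj a v → missDeg R v (X.erase a) ≤ 0 := by
        intro v hv hav
        have hv' := Finset.mem_erase.mp hv
        have := hbound v hv'.2 hv'.1.symm hav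
        have : missDeg R v (X.erase a) ≤ missDeg R v X := missDeg_mono (Finset.erase_subset _ _)
        omega
      have hb := missSum_le_of_not_adj h0 (ρ := 3) fun v hv =>
        hρ3 ▸ hmono v _ (Finset.erase_subset _ _) (Finset.mem_of_mem_erase hv)
      rw [missDeg_erase_self, hρ3] at hb
      have := missSum_erase (R := R) ha
      obtain ⟨e, he⟩ := even_missSum (R := R) ((X.erase a).erase u)
      omega

end Graph

section Coloring

set_option linter.unusedSectionVars false

variable {V : Type*} [DecidableEq V]

/-- The set of colors of the edges inside `X`. -/
def colors (c : Sym2 V → ℕ) (X : Finset V) : Finset ℕ :=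
  X.offDiag.image fun p => c s(p.1, p.2)

/-- The number of colors inside `X` that only appear on edges at `v`. -/
def satDeg (c : Sym2 V → ℕ) (v : V) (X : Finset V) : ℕ :=
  (colors c X \ colors c (X.erase v)).card

/-- `X` is partitioned into `k` paths on 3 vertices and `t` edges, whose edges have pairwise
distinct colors, and `C` is the set of these colors. -/
inductive RainbowForest (c : Sym2 V → ℕ) : ℕ → ℕ → Finset V → Finset ℕ → Prop
  | nil : RainbowForest c 0 0 ∅ ∅
  | edge {k t : ℕ} {X : Finset V} {C : Finset ℕ} (a b : V) (ha : a ∈ X) (hb : b ∈ X)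
      (hab : a ≠ b) (h : c s(a, b) ∉ C) (hX : RainbowForest c k t ((X.erase a).erase b) C) :
      RainbowForest c k (t + 1) X (insert (c s(a, b)) C)
  | path {k t : ℕ} {X : Finset V} {C : Finset ℕ} (a b d : V) (ha : a ∈ X) (hb : b ∈ X)
      (hd : d ∈ X) (hab : a ≠ b) (hbd : b ≠ d) (had : a ≠ d) (h₁ : c s(a, b) ∉ C)
      (h₂ : c s(b, d) ∉ C) (h : c s(a, b) ≠ c s(b, d))
      (hX : RainbowForest c k t (((X.erase a).erase b).erase d) C) :
      RainbowForest c (k + 1) t X (insert (c s(a, b)) (insert (c s(b, d)) C))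

/-- `X` has a spanning rainbow `kP₃ ∪ tP₂` that avoids the colors in `D`. -/
def HasForest (c : Sym2 V → ℕ) (D : Finset ℕ) (k t : ℕ) (X : Finset V) : Prop :=
  ∃ C, RainbowForest c k t X C ∧ Disjoint C D

/-- The complement of `R` is a rainbow graph on `X` containing exactly one edge of each color
outside `D`. -/
structure IsRep (c : Sym2 V → ℕ) (D : Finset ℕ) (X : Finset V) (R : SimpleGraph V) : Prop where
  notMem : ∀ u ∈ X, ∀ v ∈ X, u ≠ v → ¬ R.Adj u v → c s(u, v) ∉ D
  inj : ∀ u ∈ X, ∀ v ∈ X, u ≠ v → ¬ R.Adj u v → ∀ u' ∈ X, ∀ v' ∈ X, u' ≠ v' → ¬ R.Adj u' v' →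
    c s(u, v) = c s(u', v') → s(u, v) = s(u', v')
  missSum_add : missSum R X + 2 * (colors c X \ D).card + X.card = X.card * X.card
  missDeg_add_le : ∀ v ∈ X,
    missDeg R v X + ((colors c X \ D) \ colors c (X.erase v)).card + 1 ≤ X.card

variable {c : Sym2 V → ℕ} {C D : Finset ℕ} {X Y : Finset V} {a b d u v : V} {k t y : ℕ}

lemma mem_colors : y ∈ colors c X ↔ ∃ u ∈ X, ∃ v ∈ X, u ≠ v ∧ c s(u, v) = y := by
  simp only [colors, Finset.mem_image, Finset.mem_offDiag, Prod.exists]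
  constructor
  · rintro ⟨u, v, ⟨hu, hv, h⟩, h'⟩
    exact ⟨u, hu, v, hv, h, h'⟩
  · rintro ⟨u, hu, v, hv, h, h'⟩
    exact ⟨u, v, ⟨hu, hv, h⟩, h'⟩

lemma color_mem (hu : u ∈ X) (hv : v ∈ X) (h : u ≠ v) : c s(u, v) ∈ colors c X :=
  mem_colors.mpr ⟨u, hu, v, hv, h, rfl⟩

lemma colors_mono (h : Y ⊆ X) : colors c Y ⊆ colors c X :=
  Finset.image_subset_image (Finset.offDiag_mono h)

lemma colors_erase_subset : colors c (X.erase v) ⊆ colors c X :=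
  colors_mono (Finset.erase_subset _ _)

lemma card_colors (c : Sym2 V → ℕ) (v : V) (X : Finset V) :
    (colors c X).card = (colors c (X.erase v)).card + satDeg c v X := by
  rw [satDeg, Finset.card_sdiff_of_subset colors_erase_subset]
  have := Finset.card_le_card (colors_erase_subset (c := c) (v := v) (X := X))
  omega

/-- A color appearing inside `X` but not inside `X - v` appears on an edge at `v`. -/
lemma exists_color_eq (h : y ∈ colors c X) (h' : y ∉ colors c (X.erase v)) :
    ∃ u ∈ X, u ≠ v ∧ c s(v, u) = y := by
  obtain ⟨p, hp, q, hq, hpq, rfl⟩ := mem_colors.mp h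
  by_cases hpv : p = v
  · subst hpv
    exact ⟨q, hq, hpq.symm, rfl⟩
  by_cases hqv : q = v
  · subst hqv
    exact ⟨p, hp, hpq, by rw [Sym2.eq_swap]⟩
  exact absurd (color_mem (by simp [hp, hpv]) (by simp [hq, hqv]) hpq) h'

lemma exists_isRep (c : Sym2 V → ℕ) (D : Finset ℕ) (X : Finset V) : ∃ R, IsRep c D X R := by
  classical
  rcases X.eq_empty_or_nonempty with rfl | ⟨x₀, -⟩
  · exact ⟨⊥, by simp, by simp, by simp [missSum, colors], by simp⟩
  set E := colors c X \ D with hE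
  have hex : ∀ y ∈ E, ∃ p : V × V, p.1 ∈ X ∧ p.2 ∈ X ∧ p.1 ≠ p.2 ∧ c s(p.1, p.2) = y :=
    fun y hy => by
      obtain ⟨u, hu, v, hv, h, h'⟩ := mem_colors.mp (Finset.mem_sdiff.mp hy).1
      exact ⟨(u, v), hu, hv, h, h'⟩
  have : Nonempty (V × V) := ⟨(x₀, x₀)⟩
  choose! e he₁ he₂ hne hce using hex
  let R : SimpleGraph V :=
    { Adj := fun u v => u ≠ v ∧
        ¬ (c s(u, v) ∈ E ∧ s((e (c s(u, v))).1, (e (c s(u, v))).2) = s(u, v))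
      symm := ⟨fun u v h => by rw [Sym2.eq_swap]; exact ⟨h.1.symm, h.2⟩⟩
      loopless := ⟨fun u h => h.1 rfl⟩ }
  have hR : ∀ {u v}, u ≠ v → ¬ R.Adj u v →
      c s(u, v) ∈ E ∧ s((e (c s(u, v))).1, (e (c s(u, v))).2) = s(u, v) := fun huv h => by
    by_contra hc
    exact h ⟨huv, hc⟩
  set g : V → ℕ := fun v => (E.filter fun y => v = (e y).1 ∨ v = (e y).2).card with hg
  have hdeg : ∀ v ∈ X, missDeg R v X + g v + 1 = X.card := fun v hv => by
    have h₁ : ((X.erase v).filter fun u => ¬ R.Adj v u).card = g v := by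
      refine Finset.card_bij (fun u _ => c s(v, u)) ?_ ?_ ?_
      · intro u hu
        simp only [Finset.mem_filter, Finset.mem_erase] at hu
        obtain ⟨h, h'⟩ := hR hu.1.1.symm hu.2
        refine Finset.mem_filter.mpr ⟨h, ?_⟩
        rw [Sym2.eq_iff] at h'
        tauto
      · intro u hu u' hu' heq
        simp only [Finset.mem_filter, Finset.mem_erase] at hu hu'
        obtain ⟨-, h⟩ := hR hu.1.1.symm hu.2
        obtain ⟨-, h'⟩ := hR hu'.1.1.symm hu'.2
        have heq : c s(v, u) = c s(v, u') := heq
        rw [heq, h'] at h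
        exact (Sym2.congr_right.mp h).symm
      · intro y hy
        obtain ⟨hyE, hy⟩ := Finset.mem_filter.mp hy
        have key : ∀ u ∈ X, u ≠ v → s((e y).1, (e y).2) = s(v, u) →
            ∃ u, ∃ (_ : u ∈ (X.erase v).filter fun u => ¬ R.Adj v u), c s(v, u) = y :=
          fun u hu huv heq => by
            have hcy : c s(v, u) = y := by rw [← heq, hce y hyE]
            refine ⟨u, Finset.mem_filter.mpr ⟨Finset.mem_erase.mpr ⟨huv, hu⟩, fun h => h.2 ?_⟩, hcy⟩
            rw [hcy]
            exact ⟨hyE, heq⟩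
        rcases hy with h | h
        · exact key (e y).2 (he₂ y hyE) (h ▸ (hne y hyE).symm) (by rw [h])
        · exact key (e y).1 (he₁ y hyE) (h ▸ hne y hyE) (by rw [h, Sym2.eq_swap])
    have h₂ := Finset.card_filter_add_card_filter_not (s := X.erase v) (R.Adj v)
    have h₃ : ((X.erase v).filter (R.Adj v)).card = missDeg R v X := by
      rw [← missDeg_erase_self, missDeg]
      congr!
    have := Finset.card_erase_add_one hv
    omega
  have hsum : ∑ v ∈ X, g v = 2 * E.card := by
    have := Finset.sum_card_bipartiteAbove_eq_sum_card_bipartiteBelow (s := X) (t := E)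
      (fun v y => v = (e y).1 ∨ v = (e y).2)
    simp only [Finset.bipartiteAbove, Finset.bipartiteBelow] at this
    rw [hg, this, mul_comm, ← smul_eq_mul]
    refine Finset.sum_const_nat fun y hy => ?_
    rw [show (X.filter fun v => v = (e y).1 ∨ v = (e y).2) = {(e y).1, (e y).2} by
      ext v
      simp only [Finset.mem_filter, Finset.mem_insert, Finset.mem_singleton]
      constructor
      · exact fun h => h.2
      · rintro (rfl | rfl)
        · exact ⟨he₁ y hy, .inl rfl⟩
        · exact ⟨he₂ y hy, .inr rfl⟩]
    exact Finset.card_pair (hne y hy)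
  refine ⟨R, ?_, ?_, ?_, ?_⟩
  · intro u hu v hv huv h
    exact (Finset.mem_sdiff.mp (hR huv h).1).2
  · intro u hu v hv huv h u' hu' v' hv' huv' h' heq
    rw [← (hR huv h).2, ← (hR huv' h').2, heq]
  · have : ∑ v ∈ X, (missDeg R v X + g v + 1) = X.card * X.card := by
      rw [Finset.sum_congr rfl hdeg]
      simp
    simp only [Finset.sum_add_distrib, hsum] at this
    simp only [Finset.sum_const, smul_eq_mul, mul_one] at this
    exact this
  · intro v hv
    rw [← hdeg v hv]
    refine Nat.add_le_add_right (Nat.add_le_add_left (Finset.card_le_card fun y hy => ?_) _) _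
    obtain ⟨hyE, hy⟩ := Finset.mem_sdiff.mp hy
    refine Finset.mem_filter.mpr ⟨hyE, ?_⟩
    by_contra! hc
    refine hy (hce y hyE ▸ color_mem ?_ ?_ (hne y hyE))
    · exact Finset.mem_erase.mpr ⟨hc.1.symm, he₁ y hyE⟩
    · exact Finset.mem_erase.mpr ⟨hc.2.symm, he₂ y hyE⟩

lemma two_mul_card_colors_le (c : Sym2 V → ℕ) (X : Finset V) :
    2 * (colors c X).card + X.card ≤ X.card * X.card := by
  obtain ⟨R, hR⟩ := exists_isRep c ∅ X
  have := hR.missSum_add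
  simp only [Finset.sdiff_empty] at this
  omega

lemma satDeg_add_one_le (hv : v ∈ X) : satDeg c v X + 1 ≤ X.card := by
  obtain ⟨R, hR⟩ := exists_isRep c ∅ X
  have := hR.missDeg_add_le v hv
  simp only [Finset.sdiff_empty] at this
  unfold satDeg
  omega

lemma sum_satDeg_le (c : Sym2 V → ℕ) (X : Finset V) :
    ∑ v ∈ X, satDeg c v X ≤ 2 * (colors c X).card := by
  obtain ⟨R, hR⟩ := exists_isRep c ∅ X
  have h₁ := hR.missSum_add
  have h₂ := Finset.sum_le_sum hR.missDeg_add_le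
  simp only [Finset.sdiff_empty, Finset.sum_add_distrib] at h₁ h₂
  simp only [Finset.sum_const, smul_eq_mul, mul_one] at h₂
  have : ∑ v ∈ X, missDeg R v X = missSum R X := rfl
  unfold satDeg
  omega

lemma exists_satDeg_min (hX : X.Nonempty) :
    ∃ a ∈ X, (∀ v ∈ X, satDeg c a X ≤ satDeg c v X) ∧
      X.card * satDeg c a X ≤ 2 * (colors c X).card := by
  obtain ⟨a, ha, hmin⟩ := Finset.exists_min_image X (fun v => satDeg c v X) hX
  refine ⟨a, ha, hmin, le_trans ?_ (sum_satDeg_le c X)⟩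
  simpa using Finset.card_nsmul_le_sum X (fun v => satDeg c v X) _ hmin

lemma RainbowForest.subset_colors (h : RainbowForest c k t X C) : C ⊆ colors c X := by
  induction h with
  | nil => simp
  | edge a b ha hb hab h hX ih =>
    refine Finset.insert_subset (color_mem ha hb hab) (ih.trans (colors_mono ?_))
    exact (Finset.erase_subset _ _).trans (Finset.erase_subset _ _)
  | path a b d ha hb hd hab hbd had h₁ h₂ h hX ih =>
    refine Finset.insert_subset (color_mem ha hb hab)
      (Finset.insert_subset (color_mem hb hd hbd) (ih.trans (colors_mono ?_)))
    exact (Finset.erase_subset _ _).trans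
      ((Finset.erase_subset _ _).trans (Finset.erase_subset _ _))

/-- A recoloring that merges colors does not create rainbow forests. -/
lemma RainbowForest.of_comp {g : ℕ → ℕ} (h : RainbowForest (g ∘ c) k t X C) :
    ∃ C', RainbowForest c k t X C' ∧ C = C'.image g := by
  induction h with
  | nil => exact ⟨∅, .nil, by simp⟩
  | edge a b ha hb hab h hX ih =>
    obtain ⟨C', hC', rfl⟩ := ih
    refine ⟨_, .edge a b ha hb hab (fun h' => h ?_) hC', by simp⟩
    exact Finset.mem_image_of_mem g h'
  | path a b d ha hb hd hab hbd had h₁ h₂ h hX ih =>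
    obtain ⟨C', hC', rfl⟩ := ih
    refine ⟨_, .path a b d ha hb hd hab hbd had (fun h' => h₁ ?_) (fun h' => h₂ ?_)
      (fun h' => h ?_) hC', by simp⟩
    · exact Finset.mem_image_of_mem g h'
    · exact Finset.mem_image_of_mem g h'
    · exact congrArg g h'

lemma GraphForest.exists_rainbowForest {R : SimpleGraph V} (h : GraphForest R k t X)
    (hinj : ∀ u ∈ X, ∀ v ∈ X, u ≠ v → ¬ R.Adj u v → ∀ u' ∈ X, ∀ v' ∈ X, u' ≠ v' →
      ¬ R.Adj u' v' → c s(u, v) = c s(u', v') → s(u, v) = s(u', v')) :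
    ∃ C, RainbowForest c k t X C ∧
      ∀ y ∈ C, ∃ u ∈ X, ∃ v ∈ X, u ≠ v ∧ ¬ R.Adj u v ∧ c s(u, v) = y := by
  induction h with
  | nil => exact ⟨∅, .nil, by simp⟩
  | @edge k t X a b ha hb hab h hX ih =>
    have hsub : (X.erase a).erase b ⊆ X :=
      (Finset.erase_subset _ _).trans (Finset.erase_subset _ _)
    obtain ⟨C, hC, hgood⟩ := ih fun u hu v hv huv h u' hu' v' hv' =>
      hinj u (hsub hu) v (hsub hv) huv h u' (hsub hu') v' (hsub hv')
    refine ⟨_, .edge a b ha hb hab (fun hmem => ?_) hC, ?_⟩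
    · obtain ⟨u, hu, v, hv, huv, huv', heq⟩ := hgood _ hmem
      have := hinj u (hsub hu) v (hsub hv) huv huv' a ha b hb hab h heq
      simp only [Finset.mem_erase] at hu hv
      rw [Sym2.eq_iff] at this
      tauto
    · intro y hy
      rcases Finset.mem_insert.mp hy with rfl | hy
      · exact ⟨a, ha, b, hb, hab, h, rfl⟩
      · obtain ⟨u, hu, v, hv, h⟩ := hgood y hy
        exact ⟨u, hsub hu, v, hsub hv, h⟩
  | @path k t X a b d ha hb hd hab hbd had h₁ h₂ hX ih =>
    have hsub : ((X.erase a).erase b).erase d ⊆ X :=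
      (Finset.erase_subset _ _).trans
        ((Finset.erase_subset _ _).trans (Finset.erase_subset _ _))
    obtain ⟨C, hC, hgood⟩ := ih fun u hu v hv huv h u' hu' v' hv' =>
      hinj u (hsub hu) v (hsub hv) huv h u' (hsub hu') v' (hsub hv')
    refine ⟨_, .path a b d ha hb hd hab hbd had (fun hmem => ?_) (fun hmem => ?_)
      (fun heq => ?_) hC, ?_⟩
    · obtain ⟨u, hu, v, hv, huv, huv', heq⟩ := hgood _ hmem
      have := hinj u (hsub hu) v (hsub hv) huv huv' a ha b hb hab h₁ heq
      simp only [Finset.mem_erase] at hu hv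
      rw [Sym2.eq_iff] at this
      tauto
    · obtain ⟨u, hu, v, hv, huv, huv', heq⟩ := hgood _ hmem
      have := hinj u (hsub hu) v (hsub hv) huv huv' b hb d hd hbd h₂ heq
      simp only [Finset.mem_erase] at hu hv
      rw [Sym2.eq_iff] at this
      tauto
    · have := hinj a ha b hb hab h₁ b hb d hd hbd h₂ heq
      rw [Sym2.eq_iff] at this
      tauto
    · intro y hy
      rcases Finset.mem_insert.mp hy with rfl | hy
      · exact ⟨a, ha, b, hb, hab, h₁, rfl⟩
      rcases Finset.mem_insert.mp hy with rfl | hy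
      · exact ⟨b, hb, d, hd, hbd, h₂, rfl⟩
      · obtain ⟨u, hu, v, hv, h⟩ := hgood y hy
        exact ⟨u, hsub hu, v, hsub hv, h⟩

lemma HasForest.edge (ha : a ∈ X) (hb : b ∈ X) (hab : a ≠ b)
    (h : HasForest c {c s(a, b)} k t ((X.erase a).erase b)) : HasForest c ∅ k (t + 1) X := by
  obtain ⟨C, hC, hD⟩ := h
  exact ⟨_, .edge a b ha hb hab (Finset.disjoint_singleton_right.mp hD) hC, by simp⟩

lemma HasForest.path (ha : a ∈ X) (hb : b ∈ X) (hd : d ∈ X) (hab : a ≠ b) (hbd : b ≠ d)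
    (had : a ≠ d) (hne : c s(a, b) ≠ c s(b, d))
    (h : HasForest c {c s(a, b), c s(b, d)} k t (((X.erase a).erase b).erase d)) :
    HasForest c ∅ (k + 1) t X := by
  obtain ⟨C, hC, hD⟩ := h
  simp only [Finset.disjoint_insert_right, Finset.disjoint_singleton_right] at hD
  exact ⟨_, .path a b d ha hb hd hab hbd had hD.1 hD.2 hne hC, by simp⟩

lemma HasForest.avoid (h : HasForest c D k t X) {D' : Finset ℕ}
    (hD : ∀ y ∈ D', y ∈ colors c X → y ∈ D) : HasForest c D' k t X := by
  obtain ⟨C, hC, hCD⟩ := h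
  refine ⟨C, hC, Finset.disjoint_left.mpr fun y hy hy' => ?_⟩
  exact Finset.disjoint_left.mp hCD hy (hD y hy' (hC.subset_colors hy))

lemma IsRep.hasForest {R : SimpleGraph V} (hR : IsRep c D X R) (h : GraphForest R k t X) :
    HasForest c D k t X := by
  obtain ⟨C, hC, hgood⟩ := h.exists_rainbowForest hR.inj
  refine ⟨C, hC, Finset.disjoint_left.mpr fun y hy hy' => ?_⟩
  obtain ⟨u, hu, v, hv, huv, h, rfl⟩ := hgood y hy
  exact hR.notMem u hu v hv huv h hy'

lemma hasForest_of_card_le (ht : 1 ≤ t) (hX : X.card = 3 * k + 2 * t)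
    (hM : X.card * X.card + 4 ≤ 2 * (colors c X \ D).card + 3 * X.card) :
    HasForest c D k t X := by
  obtain ⟨R, hR⟩ := exists_isRep c D X
  have := hR.missSum_add
  exact hR.hasForest (graphForest_of_missSum_le k t X ht hX (by omega))

lemma hasForest_of_no_isolated (hk : 1 ≤ k) (ht : 1 ≤ t) (hX : X.card = 3 * k + 2 * t)
    (hM : X.card * X.card + 10 ≤ 2 * (colors c X \ D).card + 5 * X.card)
    (hiso : ∀ v ∈ X, ∃ y ∈ colors c X, y ∉ D ∧ y ∉ colors c (X.erase v)) :
    HasForest c D k t X := by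
  obtain ⟨R, hR⟩ := exists_isRep c D X
  have := hR.missSum_add
  refine hR.hasForest (graphForest_of_no_isolated k t X hk ht hX (by omega) fun v hv => ?_)
  obtain ⟨y, hy, hyD, hyv⟩ := hiso v hv
  have h₁ := hR.missDeg_add_le v hv
  have : 0 < ((colors c X \ D) \ colors c (X.erase v)).card :=
    Finset.card_pos.mpr ⟨y, by simp [hy, hyD, hyv]⟩
  omega

lemma rainbowForest_one_one {e f : V} (hY : Y.card = 5) (ha : a ∈ Y) (hb : b ∈ Y) (hd : d ∈ Y)
    (he : e ∈ Y) (hf : f ∈ Y) (hnd : [a, b, d, e, f].Nodup) (h₁ : c s(a, b) ≠ c s(b, d))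
    (h₂ : c s(e, f) ≠ c s(a, b)) (h₃ : c s(e, f) ≠ c s(b, d)) :
    RainbowForest c 1 1 Y {c s(e, f), c s(a, b), c s(b, d)} := by
  simp only [List.nodup_cons, List.mem_cons, List.not_mem_nil, or_false, not_or,
    not_false_eq_true, List.nodup_nil, and_true] at hnd
  obtain ⟨⟨hab, had, hae, haf⟩, ⟨hbd, hbe, hbf⟩, ⟨hde, hdf⟩, hef⟩ := hnd
  have hc₁ := card_erase_erase he hf hef
  have ha' : a ∈ (Y.erase e).erase f := by simp [*]
  have hb' : b ∈ (Y.erase e).erase f := by simp [*]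
  have hd' : d ∈ (Y.erase e).erase f := by simp [*]
  have hc₂ := card_erase_erase ha' hb' hab
  have hd'' : d ∈ (((Y.erase e).erase f).erase a).erase b := by
    simp [hd, hde, hdf, Ne.symm hbd, Ne.symm had]
  have hc₃ := Finset.card_erase_add_one hd''
  have hnil : ((((Y.erase e).erase f).erase a).erase b).erase d = ∅ :=
    Finset.card_eq_zero.mp (by omega)
  have := RainbowForest.path (c := c) (X := (Y.erase e).erase f) (k := 0) (t := 0) (C := ∅) a b d
    ha' hb' hd' hab hbd had (by simp) (by simp) h₁ (by rw [hnil]; exact .nil)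
  exact .edge e f he hf hef (by simp [h₂, h₃]) this

/-- If at least two colors appear on at least five vertices, then there are two disjoint edges of
different colors. -/
lemma exists_disjoint_edges (hY : 5 ≤ Y.card) (hcol : 2 ≤ (colors c Y).card) :
    ∃ p ∈ Y, ∃ q ∈ Y, ∃ z ∈ Y, ∃ w ∈ Y, [p, q, z, w].Nodup ∧ c s(p, q) ≠ c s(z, w) := by
  obtain ⟨y₁, hy₁, y₂, hy₂, hne⟩ := Finset.one_lt_card.mp hcol
  obtain ⟨p, hp, q, hq, hpq, rfl⟩ := mem_colors.mp hy₁
  obtain ⟨z, hz, w, hw, hzw, rfl⟩ := mem_colors.mp hy₂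
  by_cases hdis : [p, q, z, w].Nodup
  · exact ⟨p, hp, q, hq, z, hz, w, hw, hdis, hne⟩
  have hcard : ({p, q, z, w} : Finset V).card ≤ 3 := by
    have hor : p = z ∨ p = w ∨ q = z ∨ q = w := by grind
    rcases hor with rfl | rfl | rfl | rfl
    · exact (Finset.card_le_card (t := {p, q, w}) (by grind)).trans Finset.card_le_three
    · exact (Finset.card_le_card (t := {p, q, z}) (by grind)).trans Finset.card_le_three
    · exact (Finset.card_le_card (t := {p, q, w}) (by grind)).trans Finset.card_le_three
    · exact (Finset.card_le_card (t := {p, q, z}) (by grind)).trans Finset.card_le_three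
  have hrest : 1 < (Y \ {p, q, z, w}).card := by
    have := Finset.le_card_sdiff ({p, q, z, w} : Finset V) Y
    omega
  obtain ⟨e, he, f, hf, hef⟩ := Finset.one_lt_card.mp hrest
  simp only [Finset.mem_sdiff, Finset.mem_insert, Finset.mem_singleton, not_or] at he hf
  by_cases h : c s(p, q) = c s(e, f)
  · refine ⟨z, hz, w, hw, e, he.1, f, hf.1, by grind, fun h' => hne (h.trans h'.symm)⟩
  · refine ⟨p, hp, q, hq, e, he.1, f, hf.1, by grind, h⟩

/-- Any three colors on five vertices yield a rainbow `P₃ ∪ P₂`. -/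
lemma hasForest_one_one (hY : Y.card = 5) (hcol : 3 ≤ (colors c Y).card) :
    HasForest c ∅ 1 1 Y := by
  by_contra hno
  have H : ∀ a ∈ Y, ∀ b ∈ Y, ∀ d ∈ Y, ∀ e ∈ Y, ∀ f ∈ Y, [a, b, d, e, f].Nodup →
      c s(a, b) = c s(b, d) ∨ c s(e, f) = c s(a, b) ∨ c s(e, f) = c s(b, d) := by
    intro a ha b hb d hd e he f hf hnd
    by_contra! hc
    exact hno ⟨_, rainbowForest_one_one hY ha hb hd he hf hnd hc.1 hc.2.1 hc.2.2, by simp⟩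
  have hsw : ∀ p q, c s(p, q) = c s(q, p) := fun p q => by rw [Sym2.eq_swap]
  have key : ∀ p ∈ Y, ∀ q ∈ Y, ∀ z ∈ Y, ∀ w ∈ Y, ∀ v ∈ Y, [p, q, z, w, v].Nodup →
      c s(p, q) ≠ c s(z, w) →
      (c s(v, p) = c s(p, q) ∨ c s(v, p) = c s(z, w)) ∧
      (c s(p, z) = c s(p, q) ∨ c s(p, z) = c s(z, w)) := by
    intro p hp q hq z hz w hw v hv hnd hne
    have h₁ := H v hv p hp q hq z hz w hw (by clear H; grind)
    have h₂ := H v hv q hq p hp z hz w hw (by clear H; grind)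
    have h₃ := H v hv w hw z hz p hp q hq (by clear H; grind)
    have h₄ := H q hq v hv w hw p hp z hz (by clear H; grind)
    have h₅ := H z hz p hp q hq w hw v hv (by clear H; grind)
    have h₆ := H p hp z hz w hw q hq v hv (by clear H; grind)
    rw [hsw v q, hsw q p] at h₂
    rw [hsw w z, hsw v w] at h₃
    rw [hsw v w] at h₄
    rw [hsw z p] at h₅
    clear H hsw
    grind
  obtain ⟨p, hp, q, hq, z, hz, w, hw, hnd, hne⟩ := exists_disjoint_edges (c := c) hY.ge (by omega)
  have hc := card_erase_erase hp hq (by clear H key; grind)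
  have hc' := card_erase_erase (X := (Y.erase p).erase q) (a := z) (u := w)
    (by clear H key; grind) (by clear H key; grind) (by clear H key; grind)
  obtain ⟨v, hv⟩ := Finset.card_eq_one.mp
    (show ((((Y.erase p).erase q).erase z).erase w).card = 1 by omega)
  have hvv : v ∈ (((Y.erase p).erase q).erase z).erase w := by simp [hv]
  simp only [Finset.mem_erase] at hvv
  obtain ⟨hvw, hvz, hvq, hvp, hvY⟩ := hvv
  have n₁ : [p, q, z, w, v].Nodup := by clear H key; grind
  have n₂ : [q, p, z, w, v].Nodup := by clear H key; grind
  have n₃ : [z, w, q, p, v].Nodup := by clear H key; grind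
  have n₄ : [w, z, p, q, v].Nodup := by clear H key; grind
  have n₅ : [p, q, w, z, v].Nodup := by clear H key; grind
  have n₆ : [q, p, w, z, v].Nodup := by clear H key; grind
  have hYv : ∀ x, x ∈ Y ↔ x = p ∨ x = q ∨ x = z ∨ x = w ∨ x = v := by
    intro x
    have : x ∈ (((Y.erase p).erase q).erase z).erase w ↔ x = v := by simp [hv]
    simp only [Finset.mem_erase] at this
    constructor
    · intro hx
      by_contra! hc
      exact hc.2.2.2.2 (this.mp ⟨hc.2.2.2.1, hc.2.2.1, hc.2.1, hc.1, hx⟩)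
    · rintro (rfl | rfl | rfl | rfl | rfl) <;> assumption
  have k₁ := key p hp q hq z hz w hw v hvY n₁ hne
  have k₂ := key q hq p hp z hz w hw v hvY n₂ (by rwa [hsw q p])
  have k₃ := key z hz w hw q hq p hp v hvY n₃ (by rw [hsw q p]; exact hne.symm)
  have k₄ := key w hw z hz p hp q hq v hvY n₄ (by rw [hsw w z]; exact hne.symm)
  have k₅ := key p hp q hq w hw z hz v hvY n₅ (by rwa [hsw w z])
  have k₆ := key q hq p hp w hw z hz v hvY n₆ (by rwa [hsw w z, hsw q p])
  have hsub : colors c Y ⊆ {c s(p, q), c s(z, w)} := by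
    intro y hy
    obtain ⟨r, hr, s, hs, hrs, rfl⟩ := mem_colors.mp hy
    rw [hYv] at hr hs
    rw [Finset.mem_insert, Finset.mem_singleton]
    rw [hsw q p] at k₂ k₃ k₆
    rw [hsw w z] at k₄ k₅ k₆
    clear key H
    have := hsw q p
    have := hsw w z
    have := hsw p z
    have := hsw p w
    have := hsw q z
    have := hsw q w
    have := hsw v p
    have := hsw v q
    have := hsw v z
    have := hsw v w
    clear hYv hsw hv hnd hc hc' n₁ n₂ n₃ n₄ n₅ n₆
    rcases hr with rfl | rfl | rfl | rfl | rfl <;> rcases hs with rfl | rfl | rfl | rfl | rfl <;>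
      first | exact absurd rfl hrs | grind
  have := Finset.card_le_card hsub
  have := Finset.card_le_two (a := c s(p, q)) (b := c s(z, w))
  omega

/-- A coloring that is almost rainbow on `Z - b`, together with one edge `bq` of a new color,
contains a rainbow spanning forest on `Z`. -/
lemma hasForest_of_pendant (hk : 1 ≤ k) (ht : 1 ≤ t) (hZ : Z.card = 3 * k + 2 * t)
    (hb : b ∈ Z) (hq : q ∈ Z) (hbq : b ≠ q) (h : c s(b, q) ∉ colors c (Z.erase b))
    (hD : c s(b, q) ∉ D)
    (hM : (Z.erase b).card * (Z.erase b).card ≤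
      2 * (colors c (Z.erase b) \ D).card + (Z.erase b).card + 4) : HasForest c D k t Z := by
  classical
  obtain ⟨R, hR⟩ := exists_isRep c D (Z.erase b)
  have hsum := hR.missSum_add
  obtain ⟨R', hadj⟩ : ∃ R' : SimpleGraph V, ∀ u v, R'.Adj u v ↔ u ≠ v ∧
      ((u ≠ b ∧ v ≠ b ∧ R.Adj u v) ∨ (u = b ∧ v ≠ q) ∨ (v = b ∧ u ≠ q)) :=
    ⟨{ Adj := fun u v => u ≠ v ∧
        ((u ≠ b ∧ v ≠ b ∧ R.Adj u v) ∨ (u = b ∧ v ≠ q) ∨ (v = b ∧ u ≠ q))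
       symm := ⟨fun u v h => ⟨h.1.symm,
         h.2.imp (fun h => ⟨h.2.1, h.1, h.2.2.symm⟩) Or.symm⟩⟩
       loopless := ⟨fun u h => h.1 rfl⟩ }, fun _ _ => Iff.rfl⟩
  have hR' : ∀ u ∈ Z, ∀ v ∈ Z, u ≠ v → ¬ R'.Adj u v →
      s(u, v) = s(b, q) ∨ (u ∈ Z.erase b ∧ v ∈ Z.erase b ∧ ¬ R.Adj u v) := by
    intro u hu v hv huv h
    rw [hadj] at h
    rw [Sym2.eq_iff]
    simp only [Finset.mem_erase]
    grind
  have hdeg : ∀ v ∈ Z.erase b, missDeg R' v (Z.erase b) = missDeg R v (Z.erase b) := by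
    intro v hv
    refine congrArg Finset.card (Finset.filter_congr fun u hu => ?_)
    have hu := (Finset.mem_erase.mp hu).1
    have hv := (Finset.mem_erase.mp hv).1
    rw [hadj]
    have := fun h : R.Adj v u => h.ne
    tauto
  have hsum' : missSum R' (Z.erase b) = missSum R (Z.erase b) := Finset.sum_congr rfl hdeg
  have hbdeg : missDeg R' b Z + 2 ≤ Z.card := by
    rw [← card_erase_erase hb hq hbq]
    refine Nat.add_le_add_right (Finset.card_le_card fun u hu => ?_) 2
    obtain ⟨hu, hbu⟩ := Finset.mem_filter.mp hu
    rw [hadj] at hbu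
    simp only [Finset.mem_erase]
    have := hbu.1.symm
    tauto
  have hZc := Finset.card_erase_add_one hb
  have hsumZ := missSum_erase (R := R') hb
  have hforest : GraphForest R' k t Z := by
    refine graphForest_of_no_isolated k t Z hk ht hZ (by omega) fun v hv => ?_
    by_cases hvb : v = b
    · rwa [hvb]
    have h₁ := two_mul_missDeg_le (R := R') (X := Z.erase b) (v := v) (by simp [hv, hvb])
    have h₂ := missDeg_erase (R := R') (v := v) hb
    split_ifs at h₂ <;> omega
  obtain ⟨C, hC, hgood⟩ := hforest.exists_rainbowForest (c := c) fun u hu v hv huv huv' u' hu' v' hv'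
      hne hne' heq => by
    rcases hR' u hu v hv huv huv' with h₁ | ⟨h₁, h₂, h₃⟩ <;>
      rcases hR' u' hu' v' hv' hne hne' with h₁' | ⟨h₁', h₂', h₃'⟩
    · rw [h₁, h₁']
    · rw [h₁] at heq
      exact absurd (heq ▸ color_mem h₁' h₂' hne) h
    · rw [h₁'] at heq
      exact absurd (heq ▸ color_mem h₁ h₂ huv) h
    · exact hR.inj u h₁ v h₂ huv h₃ u' h₁' v' h₂' hne h₃' heq
  refine ⟨C, hC, Finset.disjoint_left.mpr fun y hy hy' => ?_⟩
  obtain ⟨u, hu, v, hv, huv, huv', rfl⟩ := hgood y hy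
  rcases hR' u hu v hv huv huv' with h₁ | ⟨h₁, h₂, h₃⟩
  · exact hD (h₁ ▸ hy')
  · exact hR.notMem u h₁ v h₂ huv h₃ hy'

lemma card_colors_le_sdiff_singleton (c : Sym2 V → ℕ) (X : Finset V) (y : ℕ) :
    (colors c X).card ≤ (colors c X \ {y}).card + 1 := by
  have := Finset.le_card_sdiff {y} (colors c X)
  simp only [Finset.card_singleton] at this
  omega

/-- If no color is special to `a`, an extremal number of colors forces a rainbow forest. -/
lemma hasForest_of_satDeg_eq_zero (hk : 1 ≤ k) (ht : 2 ≤ t) (hX : X.card = 3 * k + 2 * t)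
    (hcol : X.card * X.card + 16 = 2 * (colors c X).card + 7 * X.card) (ha : a ∈ X)
    (h0 : satDeg c a X = 0) : HasForest c ∅ k t X := by
  obtain ⟨k, rfl⟩ := Nat.exists_eq_add_of_le' hk
  obtain ⟨t, rfl⟩ := Nat.exists_eq_add_of_le' (Nat.le_of_succ_le ht)
  obtain ⟨m, hm⟩ : ∃ m, X.card = m + 7 := ⟨3 * k + 2 * t - 2, by omega⟩
  have hXa := Finset.card_erase_add_one ha
  obtain ⟨b, hb, hmin, hσ⟩ := exists_satDeg_min (c := c) (X := X.erase a)
    (Finset.card_pos.mp (by omega))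
  have hcXa := card_colors c a X
  have hcY := card_colors c b (X.erase a)
  have hYc := Finset.card_erase_add_one hb
  set f := (colors c X).card
  set σ := satDeg c b (X.erase a) with hσdef
  have hXa' : (X.erase a).card = m + 6 := by omega
  have hY' : ((X.erase a).erase b).card = m + 5 := by omega
  have hf : (colors c (X.erase a)).card = f := by omega
  rw [hm] at hcol
  rw [hXa', hf] at hσ
  have hσm : σ ≤ m + 2 := by
    by_contra! hc
    nlinarith
  have hab : a ≠ b := fun h => by simp [h] at hb
  have hbX := Finset.mem_of_mem_erase hb
  by_cases hiso : ∀ v ∈ (X.erase a).erase b, ∃ y ∈ colors c ((X.erase a).erase b),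
      y ∉ ({c s(a, b)} : Finset ℕ) ∧ y ∉ colors c (((X.erase a).erase b).erase v)
  · refine HasForest.edge ha hbX hab (hasForest_of_no_isolated (by omega) (by omega) (by omega)
      ?_ hiso)
    have := card_colors_le_sdiff_singleton c ((X.erase a).erase b) (c s(a, b))
    rw [hY']
    nlinarith
  push Not at hiso
  obtain ⟨d, hd, hdQ⟩ := hiso
  simp only [Finset.mem_singleton] at hdQ
  have hQc := Finset.card_erase_add_one hd
  set Q := ((X.erase a).erase b).erase d with hQ
  have hQ' : Q.card = m + 4 := by omega
  obtain ⟨hdb, hda, hdX⟩ : d ≠ b ∧ d ≠ a ∧ d ∈ X := by simpa using hd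
  have hdXa : d ∈ X.erase a := by simp [hda, hdX]
  have hσ2 : σ ≤ 2 := by
    refine (hmin d hdXa).trans ?_
    refine (Finset.card_le_card (t := {c s(b, d), c s(a, b)}) fun y hy => ?_).trans
      Finset.card_le_two
    obtain ⟨hy, hy'⟩ := Finset.mem_sdiff.mp hy
    obtain ⟨u, hu, hud, rfl⟩ := exists_color_eq hy hy'
    rw [Finset.mem_insert, Finset.mem_singleton]
    by_cases hub : u = b
    · left
      rw [hub, Sym2.eq_swap]
    · right
      by_contra hne
      refine hy' (colors_mono ?_ (hdQ _ (color_mem hd (by simp [hub, (Finset.mem_erase.mp hu).2,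
        (Finset.mem_erase.mp hu).1]) hud.symm) hne))
      rw [hQ, Finset.erase_right_comm]
      exact Finset.erase_subset _ _
  have hQcol : f ≤ (colors c Q).card + 3 := by
    have h₁ := card_colors_le_sdiff_singleton c ((X.erase a).erase b) (c s(a, b))
    have h₂ : (colors c ((X.erase a).erase b) \ {c s(a, b)}).card ≤ (colors c Q).card :=
      Finset.card_le_card fun y hy => by
        rw [Finset.mem_sdiff, Finset.mem_singleton] at hy
        exact hdQ y hy.1 hy.2
    omega
  have hQcol' : (colors c Q).card + 2 ≤ f := by
    have := two_mul_card_colors_le c Q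
    rw [hQ'] at this
    nlinarith
  have hfor : ∀ y, HasForest c {y} k (t + 1) Q := fun y => by
    refine hasForest_of_card_le (by omega) (by omega) ?_
    have := card_colors_le_sdiff_singleton c Q y
    rw [hQ']
    nlinarith
  have hnew : 1 < (colors c (X.erase a) \ colors c Q).card := by
    have := Finset.le_card_sdiff (colors c Q) (colors c (X.erase a))
    omega
  have htype : ∀ y ∈ colors c (X.erase a), y ∉ colors c Q →
      y = c s(b, d) ∨ y = c s(a, b) ∨ ∃ q ∈ Q, c s(b, q) = y := by
    intro y hy hyQ
    by_cases hyY : y ∈ colors c ((X.erase a).erase b)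
    · by_contra! hne
      exact hyQ (hdQ y hyY hne.2.1)
    · obtain ⟨u, hu, hub, rfl⟩ := exists_color_eq hy hyY
      by_cases hud : u = d
      · exact .inl (by rw [hud])
      · exact .inr (.inr ⟨u, by
          rw [hQ, Finset.mem_erase, Finset.mem_erase]; exact ⟨hud, hub, hu⟩, rfl⟩)
  by_contra hno
  have hα : ∀ q ∈ Q, c s(b, q) ∉ colors c Q → c s(b, q) = c s(a, d) := by
    intro q hq hqQ
    by_contra hne
    rw [hQ, Finset.erase_right_comm] at hqQ
    obtain ⟨hqd, hqb, hqa, hqX⟩ : q ≠ d ∧ q ≠ b ∧ q ≠ a ∧ q ∈ X := by simpa [hQ] using hq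
    have hZ := card_erase_erase ha hdX hda.symm
    refine hno (HasForest.edge ha hdX hda.symm (hasForest_of_pendant (b := b) (q := q)
      (by omega) (by omega) (by omega) ?_ ?_ hqb.symm hqQ (by simpa using hne) ?_))
    · simp [hdb.symm, hab.symm, hbX]
    · simp [hqd, hqa, hqX]
    · rw [Finset.erase_right_comm (a := d), ← hQ]
      have := card_colors_le_sdiff_singleton c Q (c s(a, d))
      rw [hQ']
      nlinarith
  have hβ : c s(b, d) ∉ colors c Q → c s(a, b) = c s(b, d) ∧ c s(a, d) = c s(b, d) := by
    intro hbd
    constructor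
    · by_contra hne
      refine hno (HasForest.path ha hbX hdX hab hdb.symm hda.symm hne ((hfor (c s(a, b))).avoid ?_))
      simp only [Finset.mem_insert, Finset.mem_singleton]
      rintro y (rfl | rfl) hy
      · rfl
      · exact absurd hy hbd
    · by_contra hne
      rw [Sym2.eq_swap (a := b)] at hne hbd
      refine hno (HasForest.path ha hdX hbX hda.symm hdb hab hne ?_)
      rw [Finset.erase_right_comm (a := d), ← hQ]
      refine (hfor (c s(a, d))).avoid ?_
      simp only [Finset.mem_insert, Finset.mem_singleton]
      rintro y (rfl | rfl) hy
      · rfl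
      · exact absurd hy hbd
  have hγ : c s(a, b) ∉ colors c Q → c s(a, d) ∉ colors c Q → c s(a, b) = c s(a, d) := by
    intro h₁ h₂
    by_contra hne
    rw [Sym2.eq_swap (a := a) (b := b)] at hne h₁
    refine hno (HasForest.path hbX ha hdX hab.symm hda.symm hdb.symm hne ?_)
    rw [Finset.erase_right_comm (a := b), ← hQ]
    refine (hfor 0).avoid ?_
    simp only [Finset.mem_insert, Finset.mem_singleton]
    rintro y (rfl | rfl) hy
    · exact absurd hy h₁
    · exact absurd hy h₂
  have hfinal : ∀ y ∈ colors c (X.erase a) \ colors c Q, y = c s(a, d) ∨ y = c s(a, b) := by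
    intro y hy
    rw [Finset.mem_sdiff] at hy
    rcases htype y hy.1 hy.2 with rfl | rfl | ⟨q, hq, rfl⟩
    · exact .inl (hβ hy.2).2.symm
    · exact .inr rfl
    · exact .inl (hα q hq hy.2)
  obtain ⟨y₁, hy₁, y₂, hy₂, hne⟩ := Finset.one_lt_card.mp hnew
  have h₁ := hfinal y₁ hy₁
  have h₂ := hfinal y₂ hy₂
  have hy₁ := (Finset.mem_sdiff.mp hy₁).2
  have hy₂ := (Finset.mem_sdiff.mp hy₂).2
  rcases h₁ with rfl | rfl <;> rcases h₂ with rfl | rfl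
  · exact hne rfl
  · exact hne (hγ hy₂ hy₁).symm
  · exact hne (hγ hy₁ hy₂)
  · exact hne rfl

/-- A vertex of positive special degree has a neighbour via a color that is special to it. -/
lemma exists_special_neighbor (h : 0 < satDeg c a X) :
    ∃ u ∈ X, u ≠ a ∧ c s(a, u) ∉ colors c (X.erase a) := by
  obtain ⟨y, hy⟩ := Finset.card_pos.mp h
  obtain ⟨hy, hy'⟩ := Finset.mem_sdiff.mp hy
  obtain ⟨u, hu, hua, rfl⟩ := exists_color_eq hy hy'
  exact ⟨u, hu, hua, hy'⟩

/-- An extremal coloring on seven vertices contains a rainbow `P₃ ∪ 2P₂`. -/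
lemma hasForest_one_two (hX : X.card = 7) (hcol : (colors c X).card = 8) (ha : a ∈ X)
    (hpos : 0 < satDeg c a X) (hle : satDeg c a X ≤ 2) : HasForest c ∅ 1 2 X := by
  obtain ⟨u, hu, hua, hau⟩ := exists_special_neighbor hpos
  have hXa := Finset.card_erase_add_one ha
  have huXa : u ∈ X.erase a := by simp [hu, hua]
  have hYc := Finset.card_erase_add_one huXa
  have hcXa := card_colors c a X
  have hcY := card_colors c u (X.erase a)
  set Y := (X.erase a).erase u with hY
  have hYXa : colors c Y ⊆ colors c (X.erase a) := colors_erase_subset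
  have hYmem : ∀ v, v ∈ Y ↔ v ≠ u ∧ v ≠ a ∧ v ∈ X := by simp [hY]
  have hs : satDeg c u (X.erase a) = (colors c (X.erase a) \ colors c Y).card := rfl
  by_cases hY3 : 3 ≤ (colors c Y).card
  · refine HasForest.edge ha hu hua.symm ((hasForest_one_one (by omega) hY3).avoid ?_)
    simp only [Finset.mem_singleton]
    rintro y rfl hy
    exact absurd (hYXa hy) hau
  have hτ : satDeg c a X + (colors c (X.erase a) \ colors c Y).card ≥ 6 := by omega
  by_cases hy : ∃ y ∈ Y, c s(a, y) ∉ colors c (X.erase a)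
  · obtain ⟨y, hy, hay⟩ := hy
    have hcard := Finset.le_card_sdiff {c s(u, y)} (colors c (X.erase a) \ colors c Y)
    rw [Finset.card_singleton] at hcard
    obtain ⟨z₁, hz₁, z₂, hz₂, hne⟩ := Finset.one_lt_card.mp
      (show 1 < ((colors c (X.erase a) \ colors c Y) \ {c s(u, y)}).card by omega)
    simp only [Finset.mem_sdiff, Finset.mem_singleton] at hz₁ hz₂
    obtain ⟨⟨hz₁, hz₁'⟩, hne₁⟩ := hz₁
    obtain ⟨⟨hz₂, hz₂'⟩, hne₂⟩ := hz₂
    obtain ⟨y₁, hy₁, hyu₁, rfl⟩ := exists_color_eq hz₁ hz₁'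
    obtain ⟨y₂, hy₂, hyu₂, rfl⟩ := exists_color_eq hz₂ hz₂'
    obtain ⟨hya₁, hy₁⟩ := Finset.mem_erase.mp hy₁
    obtain ⟨hya₂, hy₂⟩ := Finset.mem_erase.mp hy₂
    obtain ⟨hyu, hya, hyX⟩ := (hYmem y).mp hy
    have hyy₁ : y₁ ≠ y := fun h => hne₁ (by rw [h])
    have hyy₂ : y₂ ≠ y := fun h => hne₂ (by rw [h])
    have hyy : y₁ ≠ y₂ := fun h => hne (by rw [h])
    have hc₁ := card_erase_erase ha hyX hya.symm
    have hc₂ := card_erase_erase (X := (X.erase a).erase y) (a := u) (u := y₁)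
      (by simp [hu, hua, hyu.symm]) (by simp [*]) hyu₁.symm
    have hc₃ := Finset.card_erase_add_one
      (show y₂ ∈ (((X.erase a).erase y).erase u).erase y₁ by
        simp [hyy.symm, hyu₂, hyy₂, hya₂, hy₂])
    obtain ⟨p, hp, q, hq, hpq⟩ := Finset.one_lt_card.mp
      (show 1 < (((((X.erase a).erase y).erase u).erase y₁).erase y₂).card by omega)
    simp only [Finset.mem_erase] at hp hq
    obtain ⟨hp₁, hp₂, hp₃, hp₄, hp₅, hp⟩ := hp
    obtain ⟨hq₁, hq₂, hq₃, hq₄, hq₅, hq⟩ := hq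
    have hpqY : c s(p, q) ∈ colors c Y := color_mem (by simp [*]) (by simp [*]) hpq
    have hforest : RainbowForest c 1 1 ((X.erase a).erase y) _ :=
      rainbowForest_one_one (a := y₁) (b := u) (d := y₂) (e := p) (f := q) (by omega)
        (by simp [*]) (by simp [hyu.symm, *]) (by simp [*]) (by simp [*]) (by simp [*])
        (by simp [Ne.symm, *]) (by rwa [Sym2.eq_swap]) (fun h => hz₁' (by rwa [Sym2.eq_swap, ← h]))
        (fun h => hz₂' (h ▸ hpqY))
    refine HasForest.edge ha hyX hya.symm ⟨_, hforest, ?_⟩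
    rw [Finset.disjoint_singleton_right]
    simp only [Finset.mem_insert, Finset.mem_singleton, not_or]
    refine ⟨fun h => hay (h ▸ hYXa hpqY), fun h => hay ?_, fun h => hay (h ▸ hz₂)⟩
    rw [h, Sym2.eq_swap]
    exact hz₁
  push Not at hy
  have hσ : satDeg c a X ≤ 1 := by
    refine (Finset.card_le_card (t := {c s(a, u)}) fun y hyX => ?_).trans
      (Finset.card_singleton _).le
    obtain ⟨hyX, hyXa⟩ := Finset.mem_sdiff.mp hyX
    obtain ⟨w, hw, hwa, rfl⟩ := exists_color_eq hyX hyXa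
    by_cases hwu : w = u
    · simp [hwu]
    · exact absurd (hy w (by simp [*])) hyXa
  obtain ⟨p, hp, q, hq, z, hz, w, hw, hnd, hne⟩ :=
    exists_disjoint_edges (c := c) (Y := Y) (by omega) (by
      have := satDeg_add_one_le (c := c) huXa
      omega)
  simp only [List.nodup_cons, List.mem_cons, List.not_mem_nil, or_false, not_or,
    not_false_eq_true, List.nodup_nil, and_true] at hnd
  obtain ⟨⟨hpq, hpz, hpw⟩, ⟨hqz, hqw⟩, hzw⟩ := hnd
  have hpqY := color_mem (c := c) hp hq hpq
  have hzwY := color_mem (c := c) hz hw hzw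
  have hc₁ := card_erase_erase hp hq hpq
  have hc₂ := card_erase_erase (X := (Y.erase p).erase q) (a := z) (u := w)
    (by simp [hz, Ne.symm hpz, Ne.symm hqz]) (by simp [hw, Ne.symm hpw, Ne.symm hqw]) hzw
  obtain ⟨v, hv⟩ := Finset.card_pos.mp
    (show 0 < ((((Y.erase p).erase q).erase z).erase w).card by omega)
  simp only [Finset.mem_erase] at hv
  obtain ⟨hvw, hvz, hvq, hvp, hvY⟩ := hv
  have huv : c s(u, v) ∉ colors c Y := by
    intro hmem
    have hsub : colors c (X.erase a) \ colors c Y ⊆ (Y.erase v).image fun w => c s(u, w) := by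
      intro y hy
      obtain ⟨hy, hy'⟩ := Finset.mem_sdiff.mp hy
      obtain ⟨r, hr, hru, rfl⟩ := exists_color_eq hy hy'
      refine Finset.mem_image_of_mem _ (Finset.mem_erase.mpr ⟨?_, Finset.mem_erase.mpr ⟨hru, hr⟩⟩)
      rintro rfl
      exact hy' hmem
    have h₁ := (Finset.card_le_card hsub).trans Finset.card_image_le
    have h₂ := Finset.card_erase_add_one hvY
    omega
  rw [hYmem] at hp hq hz hw hvY
  have huvX : c s(u, v) ∈ colors c (X.erase a) :=
    color_mem huXa (Finset.mem_erase.mpr hvY.2) hvY.1.symm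
  have hc₃ := card_erase_erase hp.2.2 hq.2.2 hpq
  have hforest : RainbowForest c 1 1 ((X.erase p).erase q) _ :=
    rainbowForest_one_one (a := a) (b := u) (d := v) (e := z) (f := w) (by omega)
      (by simp [ha, hp.2.1.symm, hq.2.1.symm]) (by simp [hu, hp.1.symm, hq.1.symm])
      (by simp [hvp, hvq, hvY]) (by simp [Ne.symm hpz, Ne.symm hqz, hz])
      (by simp [Ne.symm hpw, Ne.symm hqw, hw])
      (by simp [hua.symm, hvY.1.symm, hvY.2.1.symm, hz.1.symm, hz.2.1.symm, hw.1.symm, hw.2.1.symm,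
        hvz, hvw, hzw])
      (fun h => hau (h ▸ huvX)) (fun h => hau (h ▸ hYXa hzwY)) (fun h => huv (h ▸ hzwY))
  refine HasForest.edge hp.2.2 hq.2.2 hpq ⟨_, hforest, ?_⟩
  rw [Finset.disjoint_singleton_right]
  simp only [Finset.mem_insert, Finset.mem_singleton, not_or]
  exact ⟨hne, fun h => hau (h ▸ hYXa hpqY), fun h => huv (h ▸ hpqY)⟩

lemma satDeg_le_card_special (c : Sym2 V → ℕ) (a : V) (X : Finset V) :
    satDeg c a X ≤
      ((X.erase a).filter fun u => c s(a, u) ∉ colors c (X.erase a)).card := by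
  refine le_trans (Finset.card_le_card fun y hy => ?_) (Finset.card_image_le (f := fun u => c s(a, u)))
  obtain ⟨hy, hy'⟩ := Finset.mem_sdiff.mp hy
  obtain ⟨u, hu, hua, rfl⟩ := exists_color_eq hy hy'
  exact Finset.mem_image_of_mem _ (Finset.mem_filter.mpr ⟨Finset.mem_erase.mpr ⟨hua, hu⟩, hy'⟩)

/-- The induction step for a single path on three vertices. -/
lemma hasForest_one_of_pos (ht : 3 ≤ t) (hX : X.card = 3 + 2 * t)
    (hcol : X.card * X.card + 16 = 2 * (colors c X).card + 7 * X.card) (ha : a ∈ X)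
    (hpos : 0 < satDeg c a X) (hσ : X.card * satDeg c a X ≤ 2 * (colors c X).card)
    (IH : ∀ Y : Finset V, Y.card + 2 = X.card →
      Y.card * Y.card + 16 ≤ 2 * (colors c Y).card + 7 * Y.card → HasForest c ∅ 1 (t - 1) Y) :
    HasForest c ∅ 1 t X := by
  classical
  obtain ⟨t, rfl⟩ := Nat.exists_eq_add_of_le' ht
  obtain ⟨m, hm⟩ : ∃ m, X.card = m + 9 := ⟨2 * t, by omega⟩
  have hXa := Finset.card_erase_add_one ha
  have hcXa := card_colors c a X
  have hXa' : (X.erase a).card = m + 8 := by omega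
  rw [hm] at hcol hσ
  set f := (colors c X).card
  set σ := satDeg c a X with hσdef
  have hσm : σ ≤ m + 3 := by
    by_contra! hc
    nlinarith
  by_contra hno
  have hspecial : ∀ u ∈ X.erase a, c s(a, u) ∉ colors c (X.erase a) →
      2 * m + 10 ≤ σ + satDeg c u (X.erase a) := by
    intro u hu hau
    by_contra! hlt
    have hYc := Finset.card_erase_add_one hu
    have hcY := card_colors c u (X.erase a)
    have hY' : ((X.erase a).erase u).card = m + 7 := by omega
    obtain ⟨hua, huX⟩ := Finset.mem_erase.mp hu
    refine hno (HasForest.edge ha huX hua.symm ((IH _ (by omega) ?_).avoid ?_))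
    · rw [hY']
      nlinarith
    · simp only [Finset.mem_singleton]
      rintro y rfl hy
      exact absurd (colors_erase_subset hy) hau
  obtain ⟨R, hR⟩ := exists_isRep c ∅ (X.erase a)
  have hsum := hR.missSum_add
  rw [Finset.sdiff_empty, hXa'] at hsum
  have hzero : ∀ u ∈ X.erase a, c s(a, u) ∉ colors c (X.erase a) →
      σ = m + 3 ∧ missDeg R u (X.erase a) = 0 := by
    intro u hu hau
    have h₁ := hspecial u hu hau
    have h₂ := hR.missDeg_add_le u hu
    rw [Finset.sdiff_empty] at h₂
    unfold satDeg at h₁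
    omega
  have hcard := satDeg_le_card_special c a X
  obtain ⟨u, hu, hua, hau⟩ := exists_special_neighbor hpos
  have hσeq := (hzero u (by simp [hu, hua]) hau).1
  set S := (X.erase a).filter fun u => c s(a, u) ∉ colors c (X.erase a) with hS
  set W := (X.erase a).filter fun u => ¬ c s(a, u) ∉ colors c (X.erase a) with hW
  have hSW : S.card + W.card = (X.erase a).card := Finset.card_filter_add_card_filter_not _
  have hsplit : ∑ v ∈ S, missDeg R v (X.erase a) + ∑ v ∈ W, missDeg R v (X.erase a) =
      missSum R (X.erase a) := Finset.sum_filter_add_sum_filter_not _ _ _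
  have hS0 : ∑ v ∈ S, missDeg R v (X.erase a) = 0 := Finset.sum_eq_zero fun v hv =>
    (hzero v (Finset.mem_filter.mp hv).1 (Finset.mem_filter.mp hv).2).2
  have hW0 : ∑ v ∈ W, missDeg R v (X.erase a) ≤ ∑ v ∈ W, 4 := by
    refine Finset.sum_le_sum fun v hv => ?_
    have h₁ : missDeg R v (X.erase a) ≤ (W.erase v).card := by
      refine Finset.card_le_card fun u hu => ?_
      obtain ⟨hu, hvu⟩ := Finset.mem_filter.mp hu
      refine Finset.mem_erase.mpr ⟨hvu.ne', Finset.mem_filter.mpr ⟨hu, fun hau => ?_⟩⟩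
      exact not_adj_of_missDeg_eq_zero (hzero u hu hau).2 (Finset.mem_filter.mp hv).1 hvu.symm
    have h₂ := Finset.card_erase_add_one hv
    omega
  rw [Finset.sum_const, smul_eq_mul] at hW0
  have : W.card ≤ 5 := by omega
  nlinarith

lemma two_mul_sub_lt_of_add_le {m f σ τ : ℕ}
    (hcol : (m + 10) * (m + 10) + 16 = 2 * f + 7 * (m + 10)) (hσ : σ ≤ m + 4) (hτ : τ ≤ m + 8)
    (hlow : 2 * m + 9 ≤ σ + τ) : 2 * (f - σ - τ) < τ * (3 * m + 16 - (σ + τ)) := by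
  obtain ⟨e, he⟩ : ∃ e, σ = m + 1 + e := ⟨σ - (m + 1), by omega⟩
  obtain ⟨r, hr⟩ : ∃ r, τ + r = m + 8 := ⟨m + 8 - τ, by omega⟩
  obtain ⟨g, hg⟩ : ∃ g, f = g + σ + τ := ⟨f - σ - τ, by
    have : σ + τ ≤ f := by nlinarith
    omega⟩
  have h₁ : 3 * m + 16 - (σ + τ) = m + 7 + r - e := by omega
  have h₂ : f - σ - τ = g := by omega
  rw [h₁, h₂]
  have he3 : e ≤ 3 := by omega
  have hre : r ≤ e := by omega
  obtain ⟨x, hx⟩ : ∃ x, m + 7 + r = x + e := ⟨m + 7 + r - e, by omega⟩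
  rw [show m + 7 + r - e = x by omega]
  interval_cases e <;> interval_cases r <;> nlinarith

/-- The induction step for at least two paths on three vertices. -/
lemma hasForest_succ_of_pos (hk : 1 ≤ k) (ht : 2 ≤ t) (hX : X.card = 3 * (k + 1) + 2 * t)
    (hcol : X.card * X.card + 16 = 2 * (colors c X).card + 7 * X.card) (ha : a ∈ X)
    (hpos : 0 < satDeg c a X) (hσ : X.card * satDeg c a X ≤ 2 * (colors c X).card)
    (IH : ∀ Y : Finset V, Y.card + 3 = X.card →
      Y.card * Y.card + 16 ≤ 2 * (colors c Y).card + 7 * Y.card → HasForest c ∅ k t Y) :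
    HasForest c ∅ (k + 1) t X := by
  obtain ⟨t, rfl⟩ := Nat.exists_eq_add_of_le' (Nat.le_of_succ_le ht)
  obtain ⟨m, hm⟩ : ∃ m, X.card = m + 10 := ⟨3 * k + 2 * t - 5, by omega⟩
  obtain ⟨u, hu, hua, hau⟩ := exists_special_neighbor hpos
  have huXa : u ∈ X.erase a := by simp [hu, hua]
  have hXa := Finset.card_erase_add_one ha
  have hcXa := card_colors c a X
  have hZc := Finset.card_erase_add_one huXa
  have hcZ := card_colors c u (X.erase a)
  have hτm := satDeg_add_one_le (c := c) huXa
  set Z := (X.erase a).erase u with hZ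
  have hZXa : colors c Z ⊆ colors c (X.erase a) := colors_erase_subset
  rw [hm] at hcol hσ
  set f := (colors c X).card
  set σ := satDeg c a X with hσdef
  set τ := satDeg c u (X.erase a) with hτdef
  have hZ' : Z.card = m + 8 := by omega
  have hσm : σ ≤ m + 4 := by
    by_contra! hc
    nlinarith
  by_contra hno
  have hIH : ∀ w ∈ Z, ∀ D : Finset ℕ, (∀ y ∈ D, y ∉ colors c (Z.erase w)) →
      σ + τ + satDeg c w Z < 3 * m + 16 → HasForest c D k (t + 1) (Z.erase w) := by
    intro w hw D hD hlt
    have hYc := Finset.card_erase_add_one hw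
    have hcY := card_colors c w Z
    refine (IH _ (by omega) ?_).avoid fun y hy hy' => absurd hy' (hD y hy)
    rw [show (Z.erase w).card = m + 7 by omega]
    nlinarith
  rcases Nat.eq_zero_or_pos τ with hτ | hτ
  · rcases Nat.lt_or_ge σ 2 with hσ2 | hσ2
    · have hforest : HasForest c ∅ (k + 1) t Z := by
        refine hasForest_of_card_le (by omega) (by omega) ?_
        rw [hZ', Finset.sdiff_empty]
        nlinarith
      · refine hno (HasForest.edge ha hu hua.symm (hforest.avoid ?_))
        simp only [Finset.mem_singleton]
        rintro y rfl hy
        exact absurd (hZXa hy) hau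
    · have hcard := Finset.le_card_sdiff {c s(a, u)} (colors c X \ colors c (X.erase a))
      have hs : satDeg c a X = (colors c X \ colors c (X.erase a)).card := rfl
      rw [Finset.card_singleton] at hcard
      obtain ⟨y, hy⟩ := Finset.card_pos.mp
        (show 0 < ((colors c X \ colors c (X.erase a)) \ {c s(a, u)}).card by omega)
      simp only [Finset.mem_sdiff, Finset.mem_singleton] at hy
      obtain ⟨⟨hy, hy'⟩, hne⟩ := hy
      obtain ⟨w, hw, hwa, rfl⟩ := exists_color_eq hy hy'
      have hwu : w ≠ u := fun h => hne (by rw [h])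
      have hwZ : w ∈ Z := by simp [*]
      have hws := satDeg_add_one_le (c := c) hwZ
      refine hno (HasForest.path hu ha hw hua hwa.symm hwu.symm ?_ ?_)
      · rw [Sym2.eq_swap]
        exact Ne.symm hne
      rw [Finset.erase_right_comm (a := u), ← hZ]
      refine hIH w hwZ _ ?_ (by omega)
      simp only [Finset.mem_insert, Finset.mem_singleton]
      rintro y (rfl | rfl) hmem
      · rw [Sym2.eq_swap] at hmem
        exact hau (hZXa (colors_erase_subset hmem))
      · exact hy' (hZXa (colors_erase_subset hmem))
  have hW : ∀ w ∈ Z, c s(u, w) ∉ colors c Z → 3 * m + 16 ≤ σ + τ + satDeg c w Z := by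
    intro w hw huw
    by_contra! hlt
    obtain ⟨hwu, hwa, hwX⟩ : w ≠ u ∧ w ≠ a ∧ w ∈ X := by simpa [hZ] using hw
    have huwX : c s(u, w) ∈ colors c (X.erase a) :=
      color_mem huXa (Finset.mem_of_mem_erase hw) hwu.symm
    refine hno (HasForest.path ha hu hwX hua.symm hwu.symm hwa.symm (fun h => hau (h ▸ huwX))
      (hIH w hw _ ?_ hlt))
    simp only [Finset.mem_insert, Finset.mem_singleton]
    rintro y (rfl | rfl) hmem
    · exact hau (hZXa (colors_erase_subset hmem))
    · exact huw (colors_erase_subset hmem)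
  have hcard := satDeg_le_card_special c u (X.erase a)
  rw [← hτdef, ← hZ] at hcard
  obtain ⟨w, hw, hwu, huw⟩ := exists_special_neighbor hτ
  have hwZ : w ∈ Z := Finset.mem_erase.mpr ⟨hwu, hw⟩
  have h₁ := hW w hwZ huw
  have h₂ := satDeg_add_one_le (c := c) hwZ
  have hlt := two_mul_sub_lt_of_add_le (τ := τ) hcol hσm (by omega) (by omega)
  have hsum := sum_satDeg_le c Z
  have hle : (Z.filter fun w => c s(u, w) ∉ colors c Z).card * (3 * m + 16 - (σ + τ)) ≤
      ∑ w ∈ Z.filter fun w => c s(u, w) ∉ colors c Z, satDeg c w Z := by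
    rw [← smul_eq_mul]
    refine Finset.card_nsmul_le_sum _ _ _ fun w hw => ?_
    have := hW w (Finset.mem_filter.mp hw).1 (Finset.mem_filter.mp hw).2
    omega
  have hle' : ∑ w ∈ Z.filter fun w => c s(u, w) ∉ colors c Z, satDeg c w Z ≤
      ∑ w ∈ Z, satDeg c w Z := Finset.sum_le_sum_of_subset (Finset.filter_subset _ _)
  have := Nat.mul_le_mul_right (3 * m + 16 - (σ + τ)) hcard
  rw [show (colors c Z).card = f - σ - τ by omega] at hsum
  omega

lemma exists_card_image_eq {S : Finset ℕ} {m : ℕ} (hm : 1 ≤ m) (hS : m ≤ S.card) :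
    ∃ g : ℕ → ℕ, (S.image g).card = m := by
  obtain ⟨T, hTS, rfl⟩ := Finset.exists_subset_card_eq hS
  obtain ⟨y, hy⟩ := Finset.card_pos.mp hm
  refine ⟨fun x => if x ∈ T then x else y, congrArg Finset.card ?_⟩
  ext x
  simp only [Finset.mem_image]
  constructor
  · rintro ⟨z, -, rfl⟩
    split_ifs with hz
    · exact hz
    · exact hy
  · exact fun hx => ⟨x, hTS hx, by simp [hx]⟩

lemma colors_comp (g : ℕ → ℕ) (c : Sym2 V → ℕ) (X : Finset V) :
    colors (g ∘ c) X = (colors c X).image g := by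
  simp only [colors, Finset.image_image]
  rfl

/-- A coloring of the edges inside `X` with at least `(|X| - 3) (|X| - 4) / 2 + 2` colors has a
rainbow spanning `kP₃ ∪ tP₂`. -/
theorem hasForest_of_le_card_colors (c : Sym2 V → ℕ) (k t : ℕ) (X : Finset V) (hk : 1 ≤ k)
    (ht : 2 ≤ t) (hX : X.card = 3 * k + 2 * t)
    (hcol : X.card * X.card + 16 ≤ 2 * (colors c X).card + 7 * X.card) :
    HasForest c ∅ k t X := by
  induction hN : X.card using Nat.strong_induction_on generalizing c k t X with
  | _ N ih =>
  subst hN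
  obtain ⟨m, hm⟩ : ∃ m, X.card * X.card + 16 = 2 * m + 7 * X.card := by
    obtain ⟨s, hs⟩ : ∃ s, X.card = s + 7 := ⟨X.card - 7, by omega⟩
    obtain ⟨r, hr⟩ := Nat.even_mul_succ_self s
    refine ⟨r + 3 * s + 8, ?_⟩
    rw [hs]
    linarith
  obtain ⟨g, hg⟩ := exists_card_image_eq (S := colors c X) (m := m) (by nlinarith) (by omega)
  rw [← colors_comp] at hg
  suffices h : HasForest (g ∘ c) ∅ k t X by
    obtain ⟨C, hC, -⟩ := h
    obtain ⟨C', hC', -⟩ := hC.of_comp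
    exact ⟨C', hC', by simp⟩
  rw [← hg] at hm
  obtain ⟨a, ha, hmin, hσ⟩ := exists_satDeg_min (c := g ∘ c) (X := X)
    (Finset.card_pos.mp (by omega))
  rcases Nat.eq_zero_or_pos (satDeg (g ∘ c) a X) with h0 | hpos
  · exact hasForest_of_satDeg_eq_zero hk ht hX hm ha h0
  rcases hk.eq_or_lt with rfl | hk
  · rcases ht.eq_or_lt with rfl | ht
    · rw [show X.card = 7 by omega] at hm hσ
      exact hasForest_one_two (by omega) (by omega) ha hpos (by omega)
    · refine hasForest_one_of_pos ht (by omega) hm ha hpos hσ fun Y hY hYcol => ?_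
      exact ih Y.card (by omega) _ _ _ Y le_rfl (by omega) (by omega) hYcol rfl
  · obtain ⟨k, rfl⟩ := Nat.exists_eq_add_of_le' hk.le
    refine hasForest_succ_of_pos (by omega) ht hX hm ha hpos hσ fun Y hY hYcol => ?_
    exact ih Y.card (by omega) _ _ _ Y (by omega) ht (by omega) hYcol rfl

set_option maxHeartbeats 1000000 in
/-- The vertices of a rainbow forest, listed along its paths and edges. -/
lemma RainbowForest.exists_embedding (h : RainbowForest c k t X C) :
    ∃ (p : Fin k → Fin 3 → V) (q : Fin t → Fin 2 → V),
      ((∀ i r, p i r ∈ X) ∧ (∀ j r, q j r ∈ X)) ∧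
      ((∀ i r i' r', p i r = p i' r' → i = i' ∧ r = r') ∧
        (∀ j r j' r', q j r = q j' r' → j = j' ∧ r = r') ∧ ∀ i r j r', p i r ≠ q j r') ∧
      ((∀ i, c s(p i 0, p i 1) ∈ C) ∧ (∀ i, c s(p i 1, p i 2) ∈ C) ∧
        ∀ j, c s(q j 0, q j 1) ∈ C) ∧
      (∀ i i', c s(p i 0, p i 1) = c s(p i' 0, p i' 1) → i = i') ∧
      (∀ i i', c s(p i 1, p i 2) = c s(p i' 1, p i' 2) → i = i') ∧
      (∀ j j', c s(q j 0, q j 1) = c s(q j' 0, q j' 1) → j = j') ∧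
      (∀ i i', c s(p i 0, p i 1) ≠ c s(p i' 1, p i' 2)) ∧
      (∀ i j, c s(p i 0, p i 1) ≠ c s(q j 0, q j 1)) ∧
      ∀ i j, c s(p i 1, p i 2) ≠ c s(q j 0, q j 1) := by
  induction h with
  | nil => exact ⟨Fin.elim0, Fin.elim0, by simp⟩
  | @edge k t X C a b ha hb hab h hX ih =>
    obtain ⟨p, q, ⟨hp, hq⟩, ⟨hpi, hqi, hpq⟩, ⟨h₁, h₂, h₃⟩, i₁, i₂, i₃, i₄, i₅, i₆⟩ := ih
    simp only [Finset.mem_erase] at hp hq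
    have n₁ : ∀ i, c s(p i 0, p i 1) ≠ c s(a, b) := fun i e => h (e ▸ h₁ i)
    have n₂ : ∀ i, c s(p i 1, p i 2) ≠ c s(a, b) := fun i e => h (e ▸ h₂ i)
    have n₃ : ∀ j, c s(q j 0, q j 1) ≠ c s(a, b) := fun j e => h (e ▸ h₃ j)
    clear h hX
    refine ⟨p, Fin.cons ![a, b] q, ?_⟩
    simp [Fin.forall_fin_succ (n := t), Fin.forall_fin_two]
    refine ⟨⟨?_, ?_, ?_⟩, ⟨?_, ⟨⟨⟨?_, ?_⟩, ?_, ?_⟩, ?_⟩, ?_⟩, ⟨?_, ?_, ?_⟩, ?_, ?_, ⟨?_, ?_⟩,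
      ?_, ?_, ?_⟩ <;> grind
  | @path k t X C a b d ha hb hd hab hbd had h h' hne hX ih =>
    obtain ⟨p, q, ⟨hp, hq⟩, ⟨hpi, hqi, hpq⟩, ⟨h₁, h₂, h₃⟩, i₁, i₂, i₃, i₄, i₅, i₆⟩ := ih
    simp only [Finset.mem_erase] at hp hq
    have n₁ : ∀ i, c s(p i 0, p i 1) ≠ c s(a, b) := fun i e => h (e ▸ h₁ i)
    have n₂ : ∀ i, c s(p i 1, p i 2) ≠ c s(a, b) := fun i e => h (e ▸ h₂ i)
    have n₃ : ∀ j, c s(q j 0, q j 1) ≠ c s(a, b) := fun j e => h (e ▸ h₃ j)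
    have n₄ : ∀ i, c s(p i 0, p i 1) ≠ c s(b, d) := fun i e => h' (e ▸ h₁ i)
    have n₅ : ∀ i, c s(p i 1, p i 2) ≠ c s(b, d) := fun i e => h' (e ▸ h₂ i)
    have n₆ : ∀ j, c s(q j 0, q j 1) ≠ c s(b, d) := fun j e => h' (e ▸ h₃ j)
    clear h h' hX
    refine ⟨Fin.cons ![a, b, d] p, q, ?_⟩
    have h3 : ∀ P : Fin 3 → Prop, (∀ r, P r) ↔ P 0 ∧ P 1 ∧ P 2 := fun P => by
      simp [Fin.forall_fin_succ]
    simp [Fin.forall_fin_succ (n := k), h3]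
    refine ⟨⟨⟨?_, ?_⟩, ?_⟩, ⟨⟨⟨⟨?_, ?_⟩, ⟨?_, ?_⟩, ?_, ?_⟩, ?_⟩, ?_, ⟨?_, ?_, ?_⟩, ?_⟩,
      ⟨?_, ?_, ?_⟩, ⟨?_, ?_⟩, ⟨?_, ?_⟩, ?_, ⟨⟨?_, ?_⟩, ?_⟩, ⟨?_, ?_⟩, ?_, ?_⟩ <;> grind

lemma linearForest_edge {e : Sym2 (Fin k × Fin 3 ⊕ Fin t × Fin 2)}
    (he : e ∈ (linearForest k t).edgeSet) :
    (∃ i, e = s(Sum.inl (i, 0), Sum.inl (i, 1))) ∨ (∃ i, e = s(Sum.inl (i, 1), Sum.inl (i, 2))) ∨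
      ∃ j, e = s(Sum.inr (j, 0), Sum.inr (j, 1)) := by
  have key : ∀ u v : Fin k × Fin 3 ⊕ Fin t × Fin 2,
      ((∃ (i : Fin k) (a b : Fin 3), u = Sum.inl (i, a) ∧ v = Sum.inl (i, b) ∧ (a : ℕ) + 1 = b) ∨
        (∃ j : Fin t, u = Sum.inr (j, 0) ∧ v = Sum.inr (j, 1))) →
      (∃ i, s(u, v) = s(Sum.inl (i, 0), Sum.inl (i, 1))) ∨
        (∃ i, s(u, v) = s(Sum.inl (i, 1), Sum.inl (i, 2))) ∨
        ∃ j, s(u, v) = s(Sum.inr (j, 0), Sum.inr (j, 1)) := by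
    rintro u v (⟨i, a, b, rfl, rfl, hab⟩ | ⟨j, rfl, rfl⟩)
    · fin_cases a <;> fin_cases b <;> simp at hab
      · exact .inl ⟨i, rfl⟩
      · exact .inr (.inl ⟨i, rfl⟩)
    · exact .inr (.inr ⟨j, rfl⟩)
  induction e with
  | _ u v =>
  rw [SimpleGraph.mem_edgeSet, linearForest, SimpleGraph.fromRel_adj] at he
  rcases he.2 with h | h
  · exact key u v h
  · rw [Sym2.eq_swap]
    exact key v u h

lemma HasForest.hasRainbowCopy {n : ℕ} {c : Sym2 (Fin n) → ℕ} {X : Finset (Fin n)}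
    (h : HasForest c D k t X) :
    HasRainbowCopy (linearForest k t) (⊤ : SimpleGraph (Fin n)) c := by
  obtain ⟨C, hC, -⟩ := h
  obtain ⟨p, q, -, ⟨hpi, hqi, hpq⟩, -, i₁, i₂, i₃, i₄, i₅, i₆⟩ := hC.exists_embedding
  have hinj : Function.Injective
      (Sum.elim (fun x : Fin k × Fin 3 => p x.1 x.2) fun x : Fin t × Fin 2 => q x.1 x.2) := by
    rintro (⟨i, r⟩ | ⟨j, r⟩) (⟨i', r'⟩ | ⟨j', r'⟩) heq
    · obtain ⟨rfl, rfl⟩ := hpi _ _ _ _ heq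
      rfl
    · exact absurd heq (hpq _ _ _ _)
    · exact absurd heq.symm (hpq _ _ _ _)
    · obtain ⟨rfl, rfl⟩ := hqi _ _ _ _ heq
      rfl
  refine ⟨⟨_, fun {u v} huv => (SimpleGraph.top_adj _ _).mpr (hinj.ne huv.ne)⟩, hinj, ?_⟩
  intro e he e' he' heq
  rcases linearForest_edge he with ⟨i, rfl⟩ | ⟨i, rfl⟩ | ⟨i, rfl⟩ <;>
    rcases linearForest_edge he' with ⟨i', rfl⟩ | ⟨i', rfl⟩ | ⟨i', rfl⟩
  · obtain rfl := i₁ _ _ heq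
    rfl
  · exact absurd heq (i₄ _ _)
  · exact absurd heq (i₅ _ _)
  · exact absurd heq.symm (i₄ _ _)
  · obtain rfl := i₂ _ _ heq
    rfl
  · exact absurd heq (i₆ _ _)
  · exact absurd heq.symm (i₅ _ _)
  · exact absurd heq.symm (i₆ _ _)
  · obtain rfl := i₃ _ _ heq
    rfl

lemma colorCount_eq_card_colors {n : ℕ} (c : Sym2 (Fin n) → ℕ) :
    colorCount n c = (colors c Finset.univ).card := by
  rw [colorCount, ← Set.ncard_coe_finset]
  congr 1
  ext y
  simp only [Set.mem_image, Finset.mem_coe, mem_colors, Finset.mem_univ, true_and]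
  constructor
  · rintro ⟨e, he, rfl⟩
    induction e with
    | _ u v => exact ⟨u, v, by simpa using he, rfl⟩
  · rintro ⟨u, v, h, rfl⟩
    exact ⟨s(u, v), by simpa using h, rfl⟩

end Coloring

/-- Upper bound: for `k ≥ 1`, `t ≥ 2`, `n = 3k + 2t`, every edge-coloring of `K_n` using
at least `(3k + 2t − 3)(3k + 2t − 4)/2 + 2` colors yields a rainbow copy of `kP₃ ∪ tP₂`;
consequently `AR(n, kP₃ ∪ tP₂) ≤ (3k + 2t − 3)(3k + 2t − 4)/2 + 1`. -/
theorem antiRamsey_linearForest_upper (k t n : ℕ) (hk : 1 ≤ k) (ht : 2 ≤ t)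
    (hn : n = 3 * k + 2 * t) :
    (∀ c : Sym2 (Fin n) → ℕ,
      (3 * k + 2 * t - 3) * (3 * k + 2 * t - 4) / 2 + 2 ≤ colorCount n c →
      HasRainbowCopy (linearForest k t) (⊤ : SimpleGraph (Fin n)) c) ∧
    antiRamsey n (linearForest k t) ≤ (3 * k + 2 * t - 3) * (3 * k + 2 * t - 4) / 2 + 1 := by
  have hmain : ∀ c : Sym2 (Fin n) → ℕ,
      (3 * k + 2 * t - 3) * (3 * k + 2 * t - 4) / 2 + 2 ≤ colorCount n c →
      HasRainbowCopy (linearForest k t) (⊤ : SimpleGraph (Fin n)) c := fun c hc => by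
    have hcard : (Finset.univ : Finset (Fin n)).card = n := by simp
    refine (hasForest_of_le_card_colors c k t Finset.univ hk ht (hcard.trans hn) ?_).hasRainbowCopy
    rw [colorCount_eq_card_colors, ← hn] at hc
    rw [hcard]
    obtain ⟨s, rfl⟩ : ∃ s, n = s + 4 := ⟨n - 4, by omega⟩
    obtain ⟨r, hr⟩ := Nat.even_mul_succ_self s
    rw [show (s + 4 - 3) * (s + 4 - 4) = 2 * r by
      rw [Nat.add_sub_cancel, show s + 4 - 3 = s + 1 by omega]; linarith,
      Nat.mul_div_cancel_left _ two_pos] at hc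
    nlinarith
  refine ⟨hmain, csSup_le' ?_⟩
  rintro m ⟨c, rfl, hc⟩
  by_contra! hlt
  exact hc (hmain c hlt)
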